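/- arXiv:1606.05950 — 2 statements merged into one kernel-verified Lean document; each statement's English description precedes it below -/
import Mathlib

section
/- Let n ≥ 7 with n ≠ 8, and let G be a bicyclic graph of order n that is not isomorphic to any of B(n,0), B(n,1), B_n^{(1)}, B_n^{3,3}. Then W(G) < W(B_n^{(1)}) < W(B(n,1)) < W(B_n^{3,3}) < W(B(n,0)). -/
open SimpleGraph Finset
open scoped Classical

noncomputable section

/-- The Wiener index of a graph, as a rational number: half of the sum of
distances over all ordered pairs of vertices (i.e. the sum over unordered pairs). -/
def wienerIndex {V : Type*} [Fintype V] (G : SimpleGraph V) : ℚ :=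
  (∑ u : V, ∑ v : V, (G.dist u v : ℚ)) / 2

/-- The transmission `D_G(v)` of a vertex: the sum of distances to all vertices. -/
def transmission {V : Type*} [Fintype V] (G : SimpleGraph V) (v : V) : ℚ :=
  ∑ x : V, (G.dist x v : ℚ)

/-- `n_u(e)` for `e = uv`: the number of vertices strictly closer to `u` than to `v`. -/
def nCloser {V : Type*} [Fintype V] (G : SimpleGraph V) (u v : V) : ℕ :=
  (Finset.univ.filter fun w => G.dist u w < G.dist v w).card

/-- `n_0(e)` for `e = uv`: the number of vertices equidistant from `u` and `v`. -/
def nEqual {V : Type*} [Fintype V] (G : SimpleGraph V) (u v : V) : ℕ :=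
  (Finset.univ.filter fun w => G.dist u w = G.dist v w).card

/-- The Szeged index, as a rational number (each edge is counted once). -/
def szeged {V : Type*} [Fintype V] (G : SimpleGraph V) : ℚ :=
  (∑ u : V, ∑ v : V,
    if G.Adj u v then (nCloser G u v : ℚ) * (nCloser G v u : ℚ) else 0) / 2

/-- The revised Szeged index, as a rational number (each edge is counted once). -/
def szegedStar {V : Type*} [Fintype V] (G : SimpleGraph V) : ℚ :=
  (∑ u : V, ∑ v : V,
    if G.Adj u v then
      ((nCloser G u v : ℚ) + (nEqual G u v : ℚ) / 2) *
        ((nCloser G v u : ℚ) + (nEqual G u v : ℚ) / 2)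
    else 0) / 2

/-- The cycle `C_k` on the vertices `0, 1, …, k-1`. -/
def cycleG (k : ℕ) : SimpleGraph (Fin k) :=
  SimpleGraph.fromRel (fun a b => a.val + 1 = b.val ∨ (a.val = 0 ∧ b.val = k - 1))

/-- The lollipop `L_{n,r}`: the cycle `C_r` on `0, …, r-1` together with the
path `r-1, r, …, n-1` attached at the cycle vertex `r-1`. -/
def lollipop (n r : ℕ) : SimpleGraph (Fin n) :=
  SimpleGraph.fromRel (fun a b => a.val + 1 = b.val ∨ (a.val = 0 ∧ b.val = r - 1))

/-- `H_n^0`: a triangle `0,1,2`, a path `2, 3, …, n-3` (so `u_1 = 2`, `u_{n-4} = n-3`)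
and two pendant vertices `n-2, n-1` attached at `n-3`. -/
def Hgraph0 (n : ℕ) : SimpleGraph (Fin n) :=
  SimpleGraph.fromRel (fun a b =>
    (a.val + 1 = b.val ∧ b.val ≤ n - 2) ∨ (a.val = 0 ∧ b.val = 2) ∨
    (a.val = n - 3 ∧ b.val = n - 1))

/-- `H_n^1`: a triangle `0,1,2`, a path `2, 3, …, n-4` (so `u_1 = 2`, `u_{n-5} = n-4`),
a path of length two `n-4, n-3, n-2` and a pendant vertex `n-1` attached at `n-4`. -/
def Hgraph1 (n : ℕ) : SimpleGraph (Fin n) :=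
  SimpleGraph.fromRel (fun a b =>
    (a.val + 1 = b.val ∧ b.val ≤ n - 2) ∨ (a.val = 0 ∧ b.val = 2) ∨
    (a.val = n - 4 ∧ b.val = n - 1))

/-- `H_n^2`: a `4`-cycle `0,1,2,3`, a path `3, 4, …, n-3` (so `u_1 = 3`, `u_{n-5} = n-3`)
and two pendant vertices `n-2, n-1` attached at `n-3`. -/
def Hgraph2 (n : ℕ) : SimpleGraph (Fin n) :=
  SimpleGraph.fromRel (fun a b =>
    (a.val + 1 = b.val ∧ b.val ≤ n - 2) ∨ (a.val = 0 ∧ b.val = 3) ∨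
    (a.val = n - 3 ∧ b.val = n - 1))

/-- `H_n^3`: a triangle `0,1,2`, a path `2, 3, …, n-4` (so `u_1 = 2`, `u_{n-5} = n-4`),
two pendant vertices `n-3, n-2` attached at `n-4`, and a pendant vertex `n-1`
attached at the second triangle vertex `0`. -/
def Hgraph3 (n : ℕ) : SimpleGraph (Fin n) :=
  SimpleGraph.fromRel (fun a b =>
    (a.val + 1 = b.val ∧ b.val ≤ n - 3) ∨ (a.val = 0 ∧ b.val = 2) ∨
    (a.val = n - 4 ∧ b.val = n - 2) ∨ (a.val = 0 ∧ b.val = n - 1))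

/-- `B(n,s)`: `K_4^-` on the vertices `x = n-s-4`, `u = n-s-3`, `y = n-s-2`, `v = n-1`
(with the edge `xy` missing), a path on `n-s-4` vertices `0, …, n-s-5` attached at `x`,
and a path on `s` vertices `n-s-1, …, n-2` attached at `y`. -/
def Bgraph (n s : ℕ) : SimpleGraph (Fin n) :=
  SimpleGraph.fromRel (fun a b =>
    (a.val + 1 = b.val ∧ b.val ≤ n - 2) ∨
    (b.val = n - 1 ∧ (a.val = n - s - 4 ∨ a.val = n - s - 3 ∨ a.val = n - s - 2)))

/-- `B_n^{(1)}`: `K_4^-` on the vertices `n-4, n-3, n-2, n-1` (with the edge between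
`n-2` and `n-1` missing), with an end-vertex of the path `0, 1, …, n-4` identified with
the degree-`3` vertex `n-4` of `K_4^-`. -/
def Bn1 (n : ℕ) : SimpleGraph (Fin n) :=
  SimpleGraph.fromRel (fun a b =>
    (a.val + 1 = b.val ∧ b.val ≤ n - 3) ∨
    (a.val = n - 4 ∧ b.val = n - 2) ∨ (a.val = n - 4 ∧ b.val = n - 1) ∨
    (a.val = n - 3 ∧ b.val = n - 2) ∨ (a.val = n - 3 ∧ b.val = n - 1))

/-- `B_n^{3,3}`: two triangles `0,1,2` and `n-3,n-2,n-1` joined by the path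
`2, 3, …, n-3` of length `n-5`. -/
def B33 (n : ℕ) : SimpleGraph (Fin n) :=
  SimpleGraph.fromRel (fun a b =>
    a.val + 1 = b.val ∨ (a.val = 0 ∧ b.val = 2) ∨ (a.val = n - 3 ∧ b.val = n - 1))

/-- `C_r(P_{m 0 + 1}, …, P_{m (r-1) + 1})`: the unicyclic graph obtained from the cycle
`C_r` by identifying, for each `i`, one end-vertex of a path on `m i + 1` vertices with
the `i`-th cycle vertex.  The vertex `⟨i, 0⟩` is the cycle vertex `v_i`, and `⟨i, j⟩`
for `j ≥ 1` are the remaining vertices of the path attached at `v_i`. -/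
def cyclePaths (r : ℕ) (m : Fin r → ℕ) : SimpleGraph (Σ i : Fin r, Fin (m i + 1)) :=
  SimpleGraph.fromRel (fun a b =>
    (a.2.val = 0 ∧ b.2.val = 0 ∧ (a.1.val + 1) % r = b.1.val) ∨
    (a.1 = b.1 ∧ a.2.val + 1 = b.2.val))

/-- The graph obtained from vertex-disjoint graphs `G₁`, `G₂` by identifying the
vertex `v₁` of `G₁` with the vertex `v₂` of `G₂`; the common vertex is `Sum.inl v₁`. -/
def glue {V₁ V₂ : Type*} (G₁ : SimpleGraph V₁) (G₂ : SimpleGraph V₂) (v₁ : V₁) (v₂ : V₂) :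
    SimpleGraph (V₁ ⊕ {x : V₂ // x ≠ v₂}) :=
  SimpleGraph.fromRel (fun a b =>
    match a, b with
    | Sum.inl a, Sum.inl b => G₁.Adj a b
    | Sum.inr a, Sum.inr b => G₂.Adj a.val b.val
    | Sum.inl a, Sum.inr b => a = v₁ ∧ G₂.Adj v₂ b.val
    | Sum.inr _, Sum.inl _ => False)

/-- The spider `A_{n,4}`: a center `n-5` with one leg `n-5, n-6, …, 0` of length
`n-5` and four legs of length one ending at the unit leaves `n-4, n-3, n-2, n-1`;
the non-unit leaf is the vertex `0`. -/
def spiderA (n : ℕ) : SimpleGraph (Fin n) :=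
  SimpleGraph.fromRel (fun a b =>
    (a.val + 1 = b.val ∧ b.val ≤ n - 5) ∨ (a.val = n - 5 ∧ n - 4 ≤ b.val))

/-- The theta graph `B_{k,l,t}` on `k + l + t - 1` vertices: the vertices `u = 0` and
`w = k` joined by three internally disjoint paths of lengths `k`, `l`, `t`, with
internal vertices `1, …, k-1`, `k+1, …, k+l-1` and `k+l, …, k+l+t-2` respectively. -/
def theta (k l t : ℕ) : SimpleGraph (Fin (k + l + t - 1)) :=
  SimpleGraph.fromRel (fun a b =>
    (a.val + 1 = b.val ∧ b.val ≤ k) ∨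
    (a.val = 0 ∧ b.val = k + 1) ∨
    (a.val + 1 = b.val ∧ k + 1 ≤ a.val ∧ b.val ≤ k + l - 1) ∨
    (a.val = k ∧ b.val = k + l - 1) ∨
    (a.val = 0 ∧ b.val = k + l) ∨
    (a.val + 1 = b.val ∧ k + l ≤ a.val ∧ b.val ≤ k + l + t - 2) ∨
    (a.val = k ∧ b.val = k + l + t - 2))

/-- A set of vertices `B` induces a subgraph with no cut vertex. -/
def NoCutVtx {V : Type*} (G : SimpleGraph V) (B : Set V) : Prop :=
  ∀ v ∈ B, (G.induce (B \ {v})).Preconnected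

/-- `B` is (the vertex set of) a block of `G`: a maximal connected subgraph of `G`
without a cut vertex. -/
def IsBlock {V : Type*} (G : SimpleGraph V) (B : Set V) : Prop :=
  (G.induce B).Connected ∧ NoCutVtx G B ∧
  ∀ C : Set V, B ⊆ C → (G.induce C).Connected → NoCutVtx G C → C = B

section Deletion

variable {V : Type*}

/-- The graph obtained from `G` by deleting the vertex `x`. -/
def delVert (G : SimpleGraph V) (x : V) : SimpleGraph {y // y ≠ x} :=
  G.comap Subtype.val

theorem delVert_adj (G : SimpleGraph V) (x : V) (a b : {y // y ≠ x}) :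
    (delVert G x).Adj a b ↔ G.Adj a.1 b.1 := Iff.rfl

/-- The number of neighbours of a vertex. -/
def valency [Fintype V] (G : SimpleGraph V) (v : V) : ℕ :=
  (univ.filter fun y => G.Adj v y).card

/-- The sum of the distances from a vertex, as an integer. -/
def distSum [Fintype V] (G : SimpleGraph V) (v : V) : ℤ :=
  ∑ y : V, (G.dist v y : ℤ)

/-- The sum of distances over all ordered pairs of vertices, as an integer. -/
def pairDistSum [Fintype V] (G : SimpleGraph V) : ℤ :=
  ∑ u : V, ∑ v : V, (G.dist u v : ℤ)

theorem wienerIndex_eq_pairDistSum [Fintype V] (G : SimpleGraph V) :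
    wienerIndex G = (pairDistSum G : ℚ) / 2 := by
  simp [wienerIndex, pairDistSum]

theorem card_ne_add_one [Fintype V] (x : V) :
    Fintype.card {y // y ≠ x} + 1 = Fintype.card V := by
  have h := Fintype.card_subtype_compl (fun y => y = x)
  have h1 : 0 < Fintype.card V := Fintype.card_pos_iff.2 ⟨x⟩
  rw [Fintype.card_subtype_eq] at h
  have h2 : Fintype.card {y // y ≠ x} = Fintype.card V - 1 := by
    rw [← h]
  omega

theorem sum_sum_delete [Fintype V] {M : Type*} [AddCommMonoid M] (F : V → V → M) (x : V)
    (hx : F x x = 0) (hs : ∀ y z, F y z = F z y) :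
    ∑ y, ∑ z, F y z = (∑ z, F x z) + (∑ z, F x z) +
      ∑ y : {y // y ≠ x}, ∑ z : {y // y ≠ x}, F y z := by
  rw [Fintype.sum_eq_add_sum_subtype_ne _ x]
  have h : ∀ y : {y // y ≠ x}, ∑ z, F y z = F x y + ∑ z : {y // y ≠ x}, F y z := by
    intro y
    rw [Fintype.sum_eq_add_sum_subtype_ne _ x, hs]
  simp_rw [h]
  rw [Finset.sum_add_distrib, add_assoc]
  congr 2
  rw [Fintype.sum_eq_add_sum_subtype_ne (fun z => F x z) x, hx, zero_add]

theorem valency_eq_sum [Fintype V] (G : SimpleGraph V) (v : V) :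
    valency G v = ∑ y, if G.Adj v y then 1 else 0 := by
  rw [valency, Finset.card_filter]

theorem sum_valency_delVert [Fintype V] (G : SimpleGraph V) (x : V) :
    ∑ v, valency G v = 2 * valency G x + ∑ v, valency (delVert G x) v := by
  simp_rw [valency_eq_sum]
  rw [sum_sum_delete (fun y z => if G.Adj y z then 1 else 0) x (by simp)
    (by intro y z; simp only [G.adj_comm]), two_mul]
  rfl

theorem sum_valency_eq [Fintype V] (G : SimpleGraph V) :
    ∑ v, valency G v = 2 * G.edgeSet.ncard := by
  have h := G.sum_degrees_eq_twice_card_edges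
  rw [Set.ncard_eq_toFinset_card', ← SimpleGraph.edgeFinset, ← h]
  refine Finset.sum_congr rfl fun v _ => ?_
  rw [valency, ← SimpleGraph.card_neighborFinset_eq_degree, SimpleGraph.neighborFinset_eq_filter]

theorem valency_delVert [Fintype V] (G : SimpleGraph V) (x : V) (y : {y // y ≠ x}) :
    valency G y = valency (delVert G x) y + if G.Adj x y then 1 else 0 := by
  rw [valency_eq_sum, valency_eq_sum, Fintype.sum_eq_add_sum_subtype_ne _ x, add_comm]
  simp only [G.adj_comm, delVert_adj]

theorem dist_le_delVert (G : SimpleGraph V) (x : V) (hc : (delVert G x).Connected)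
    (a b : {y // y ≠ x}) : G.dist a.1 b.1 ≤ (delVert G x).dist a b := by
  obtain ⟨p, hp⟩ := hc.exists_walk_length_eq_dist a b
  rw [← hp]
  let f : delVert G x →g G := ⟨Subtype.val, fun h => h⟩
  have := SimpleGraph.dist_le (p.map f)
  rwa [SimpleGraph.Walk.length_map] at this

theorem pairDistSum_le_delVert [Fintype V] (G : SimpleGraph V) (x : V)
    (hc : (delVert G x).Connected) :
    pairDistSum G ≤ 2 * distSum G x + pairDistSum (delVert G x) := by
  rw [pairDistSum, sum_sum_delete (fun y z => (G.dist y z : ℤ)) x (by simp)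
    (by intro y z; rw [SimpleGraph.dist_comm]), two_mul]
  refine add_le_add le_rfl (Finset.sum_le_sum fun y _ => Finset.sum_le_sum fun z _ => ?_)
  exact_mod_cast dist_le_delVert G x hc y z

theorem distSum_le_delVert [Fintype V] (G : SimpleGraph V) (hG : G.Connected) (v : V)
    (w : {y // y ≠ v}) (hvw : G.Adj v w) (hc : (delVert G v).Connected) :
    distSum G v ≤ (Fintype.card V : ℤ) - 1 + distSum (delVert G v) w := by
  rw [distSum, Fintype.sum_eq_add_sum_subtype_ne _ v]
  have h : ∀ y : {y // y ≠ v}, (G.dist v y : ℤ) ≤ 1 + ((delVert G v).dist w y : ℤ) := by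
    intro y
    have h1 := hG.dist_triangle (u := v) (v := w.1) (w := y.1)
    have h2 := dist_le_delVert G v hc w y
    have h3 : G.dist v w = 1 := SimpleGraph.dist_eq_one_iff_adj.2 hvw
    omega
  have h2 := Finset.sum_le_sum (s := univ) fun y _ => h y
  rw [Finset.sum_add_distrib] at h2
  have h3 := card_ne_add_one v
  simp only [sum_const, Finset.card_univ, nsmul_eq_mul, mul_one] at h2
  simp only [SimpleGraph.dist_self, Nat.cast_zero, zero_add]
  have h4 : ((Fintype.card {y // y ≠ v} : ℕ) : ℤ) + 1 = Fintype.card V := by exact_mod_cast h3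
  unfold distSum
  linarith

end Deletion

section Layers

variable {V : Type*}

theorem exists_adj_dist_eq (G : SimpleGraph V) (hG : G.Connected) (x y : V) (k : ℕ)
    (h : G.dist x y = k + 1) : ∃ z, G.Adj y z ∧ G.dist x z = k := by
  obtain ⟨p, hp⟩ := hG.exists_walk_length_eq_dist y x
  rw [SimpleGraph.dist_comm, h] at hp
  cases p with
  | nil => simp at hp
  | @cons _ z _ hyz q =>
    refine ⟨z, hyz, ?_⟩
    have h1 := SimpleGraph.dist_le q
    rw [SimpleGraph.dist_comm] at h1
    simp only [SimpleGraph.Walk.length_cons] at hp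
    have h2 := hG.dist_triangle (u := x) (v := z) (w := y)
    have h3 : G.dist z y = 1 := SimpleGraph.dist_eq_one_iff_adj.2 hyz.symm
    omega

theorem exists_vertex_at_dist (G : SimpleGraph V) (hG : G.Connected) (x : V) (k : ℕ) :
    ∀ (m : ℕ) (y : V), G.dist x y = k + m → ∃ z, G.dist x z = k := by
  intro m
  induction m with
  | zero => intro y h; exact ⟨y, h⟩
  | succ m ih =>
    intro y h
    obtain ⟨z, -, hz⟩ := exists_adj_dist_eq G hG x y (k + m) h
    exact ih z hz

variable [Fintype V]

/-- The number of vertices at distance more than `j` from `x`. -/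
def farCount (G : SimpleGraph V) (x : V) (j : ℕ) : ℕ :=
  (univ.filter fun y => j < G.dist x y).card

/-- The sum of the parts of the distances from `x` exceeding `j`. -/
def excessSum (G : SimpleGraph V) (x : V) (j : ℕ) : ℕ :=
  ∑ y, (G.dist x y - j)

theorem distSum_eq_excessSum (G : SimpleGraph V) (x : V) : distSum G x = excessSum G x 0 := by
  simp [distSum, excessSum]

theorem excessSum_succ (G : SimpleGraph V) (x : V) (j : ℕ) :
    excessSum G x j = farCount G x j + excessSum G x (j + 1) := by
  rw [excessSum, excessSum, farCount, Finset.card_filter, ← Finset.sum_add_distrib]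
  refine Finset.sum_congr rfl fun y _ => ?_
  split_ifs <;> omega

theorem farCount_succ (G : SimpleGraph V) (x : V) (j : ℕ) :
    farCount G x j = farCount G x (j + 1) + (univ.filter fun y => G.dist x y = j + 1).card := by
  rw [farCount, farCount, Finset.card_filter, Finset.card_filter, Finset.card_filter,
    ← Finset.sum_add_distrib]
  refine Finset.sum_congr rfl fun y _ => ?_
  split_ifs <;> omega

theorem farCount_succ_lt (G : SimpleGraph V) (hG : G.Connected) (x : V) (j : ℕ)
    (h : farCount G x j ≠ 0) : farCount G x (j + 1) < farCount G x j := by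
  rw [farCount_succ G x j]
  obtain ⟨y, hy⟩ := Finset.card_pos.1 (Nat.pos_of_ne_zero h)
  obtain ⟨z, hz⟩ := exists_vertex_at_dist G hG x (j + 1) (G.dist x y - (j + 1)) y
    (by have := (Finset.mem_filter.1 hy).2; omega)
  have : 0 < (univ.filter fun y => G.dist x y = j + 1).card :=
    Finset.card_pos.2 ⟨z, by simp [hz]⟩
  omega

theorem excessSum_eq_zero (G : SimpleGraph V) (x : V) (j : ℕ) (h : farCount G x j = 0) :
    excessSum G x j = 0 := by
  rw [farCount, Finset.card_eq_zero, Finset.filter_eq_empty_iff] at h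
  refine Finset.sum_eq_zero fun y hy => ?_
  have := h hy
  omega

theorem two_mul_excessSum_le (G : SimpleGraph V) (hG : G.Connected) (x : V) :
    ∀ (s j : ℕ), farCount G x j ≤ s → 2 * excessSum G x j ≤ s * (s + 1) := by
  intro s
  induction s with
  | zero =>
    intro j h
    rw [excessSum_eq_zero G x j (by omega)]
  | succ s ih =>
    intro j h
    by_cases h0 : farCount G x j = 0
    · rw [excessSum_eq_zero G x j h0]; simp
    · have h1 := farCount_succ_lt G hG x j h0
      have h2 := ih (j + 1) (by omega)
      rw [excessSum_succ]
      nlinarith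

theorem dist_of_farCount_one (G : SimpleGraph V) (hG : G.Connected) (x : V)
    (hdeg : ∀ v, 2 ≤ valency G v) (j : ℕ) (h : farCount G x (j + 1) = 1) :
    3 ≤ farCount G x j := by
  obtain ⟨y, hy⟩ := Finset.card_eq_one.1 h
  have hmem : ∀ z, j + 1 < G.dist x z ↔ z = y := by
    intro z
    have := Finset.ext_iff.1 hy z
    simpa using this
  have hy1 : G.dist x y = j + 2 := by
    have h1 := (hmem y).2 rfl
    by_contra hne
    obtain ⟨z, hz⟩ := exists_vertex_at_dist G hG x (j + 2) (G.dist x y - (j + 2)) y (by omega)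
    have := (hmem z).1 (by omega)
    subst this
    omega
  have hsub : (univ.filter fun z => G.Adj y z) ⊆ univ.filter fun z => G.dist x z = j + 1 := by
    intro z hz
    have hz := (Finset.mem_filter.1 hz).2
    have h1 : ¬ (j + 1 < G.dist x z) := by
      rw [hmem]; exact hz.ne'
    have h2 := hG.dist_triangle (u := x) (v := z) (w := y)
    have h3 : G.dist z y = 1 := SimpleGraph.dist_eq_one_iff_adj.2 hz.symm
    simp only [Finset.mem_filter, Finset.mem_univ, true_and]
    omega
  have h1 := Finset.card_le_card hsub
  have h2 := hdeg y
  rw [valency] at h2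
  have h3 := farCount_succ G x j
  omega

theorem two_mul_excessSum_le_of_two_le_valency (G : SimpleGraph V) (hG : G.Connected) (x : V)
    (hdeg : ∀ v, 2 ≤ valency G v) :
    ∀ (s j : ℕ), 2 ≤ s → farCount G x j ≤ s → 2 * excessSum G x j + 2 ≤ s * (s + 1) := by
  intro s
  induction s with
  | zero => intro j h; omega
  | succ s ih =>
    intro j hs h
    by_cases h0 : farCount G x j = 0
    · rw [excessSum_eq_zero G x j h0]; nlinarith
    have h1 := farCount_succ_lt G hG x j h0
    rw [excessSum_succ]
    by_cases h2 : farCount G x (j + 1) = 0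
    · rw [excessSum_eq_zero G x (j + 1) h2]; nlinarith
    by_cases h3 : farCount G x (j + 1) = 1
    · have h4 := dist_of_farCount_one G hG x hdeg j h3
      have h5 := two_mul_excessSum_le G hG x 1 (j + 1) (by omega)
      nlinarith
    · have h5 := ih (j + 1) (by omega) (by omega)
      nlinarith

theorem farCount_zero (G : SimpleGraph V) (hG : G.Connected) (x : V) :
    farCount G x 0 + 1 = Fintype.card V := by
  have h : (univ.filter fun y => 0 < G.dist x y) = univ.erase x := by
    ext y
    simp only [Finset.mem_filter, Finset.mem_univ, true_and, Finset.mem_erase, and_true]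
    rw [pos_iff_ne_zero, Ne, hG.dist_eq_zero_iff, eq_comm]
  rw [farCount, h, Finset.card_erase_of_mem (Finset.mem_univ _), Finset.card_univ]
  have : 0 < Fintype.card V := Fintype.card_pos_iff.2 ⟨x⟩
  omega

theorem farCount_one (G : SimpleGraph V) (hG : G.Connected) (x : V) :
    farCount G x 1 + valency G x + 1 = Fintype.card V := by
  have h1 := farCount_zero G hG x
  have h2 := farCount_succ G x 0
  simp only [zero_add, SimpleGraph.dist_eq_one_iff_adj] at h2
  rw [valency]
  omega

theorem distSum_le_of_connected (G : SimpleGraph V) (hG : G.Connected) (x : V) :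
    2 * distSum G x ≤ (Fintype.card V : ℤ) * (Fintype.card V - 1) := by
  have h1 := farCount_zero G hG x
  have h2 := two_mul_excessSum_le G hG x (farCount G x 0) 0 le_rfl
  rw [distSum_eq_excessSum, ← h1]
  zify at h2
  push_cast
  linarith

theorem distSum_le_of_two_le_valency (G : SimpleGraph V) (hG : G.Connected) (x : V)
    (hx : 2 ≤ valency G x) :
    2 * distSum G x ≤ (Fintype.card V : ℤ) ^ 2 - 3 * Fintype.card V + 4 := by
  have h1 := farCount_zero G hG x
  have h3 := farCount_one G hG x
  obtain ⟨s, hs⟩ : ∃ s, Fintype.card V = s + 3 := ⟨Fintype.card V - 3, by omega⟩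
  have h2 := two_mul_excessSum_le G hG x s 1 (by omega)
  have h4 := excessSum_succ G x 0
  rw [distSum_eq_excessSum]
  zify at h1 h2 h4 hs
  rw [hs] at h1 ⊢
  simp only [zero_add] at h4
  nlinarith

theorem distSum_le_of_second_layer (G : SimpleGraph V) (hG : G.Connected) (x : V)
    (hx : valency G x = 2) (h2 : 2 ≤ (univ.filter fun y => G.dist x y = 2).card) :
    2 * distSum G x ≤ (Fintype.card V : ℤ) ^ 2 - 5 * Fintype.card V + 12 := by
  have h0 := farCount_zero G hG x
  have h1 := farCount_one G hG x
  have h3 : farCount G x 1 = farCount G x 2 + (univ.filter fun y => G.dist x y = 2).card :=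
    farCount_succ G x 1
  obtain ⟨s, hs⟩ : ∃ s, Fintype.card V = s + 5 := ⟨Fintype.card V - 5, by omega⟩
  have h4 := two_mul_excessSum_le G hG x s 2 (by omega)
  have h5 := excessSum_succ G x 0
  have h6 := excessSum_succ G x 1
  rw [distSum_eq_excessSum]
  zify at h0 h1 h3 h4 h5 h6 hs hx
  rw [hs] at h0 h1 ⊢
  simp only [zero_add] at h5 h6
  norm_num at h6
  nlinarith

theorem distSum_lt_of_second_layer (G : SimpleGraph V) (hG : G.Connected) (x : V)
    (hx : valency G x = 2) (h2 : 2 ≤ (univ.filter fun y => G.dist x y = 2).card)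
    (hdeg : ∀ v, 2 ≤ valency G v) (hn : 7 ≤ Fintype.card V) :
    2 * distSum G x < (Fintype.card V : ℤ) ^ 2 - 5 * Fintype.card V + 12 := by
  have h0 := farCount_zero G hG x
  have h1 := farCount_one G hG x
  have h3 : farCount G x 1 = farCount G x 2 + (univ.filter fun y => G.dist x y = 2).card :=
    farCount_succ G x 1
  obtain ⟨s, hs⟩ : ∃ s, Fintype.card V = s + 5 := ⟨Fintype.card V - 5, by omega⟩
  have h4 := two_mul_excessSum_le_of_two_le_valency G hG x hdeg s 2 (by omega) (by omega)
  have h5 := excessSum_succ G x 0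
  have h6 := excessSum_succ G x 1
  rw [distSum_eq_excessSum]
  zify at h0 h1 h3 h4 h5 h6 hs hx
  rw [hs] at h0 h1 ⊢
  simp only [zero_add] at h5 h6
  norm_num at h6
  nlinarith

end Layers

section Bounds

theorem valency_pos {V : Type*} [Fintype V] (G : SimpleGraph V) (hG : G.Connected)
    (hn : 2 ≤ Fintype.card V) (v : V) : 1 ≤ valency G v := by
  have : Nontrivial V := Fintype.one_lt_card_iff_nontrivial.1 hn
  obtain ⟨w, hw⟩ := hG.preconnected.exists_adj_of_nontrivial v
  exact Finset.card_pos.2 ⟨w, by simpa using hw⟩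

theorem exists_unique_neighbor {V : Type*} [Fintype V] (G : SimpleGraph V) (v : V)
    (hv : valency G v = 1) : ∃ w : {y // y ≠ v}, ∀ y, G.Adj v y ↔ y = w.1 := by
  obtain ⟨w, hw⟩ := Finset.card_eq_one.1 hv
  have h : ∀ y, G.Adj v y ↔ y = w := fun y => by simpa using Finset.ext_iff.1 hw y
  exact ⟨⟨w, ((h w).2 rfl).ne'⟩, h⟩

theorem exists_two_neighbors {V : Type*} [Fintype V] (G : SimpleGraph V) (v : V)
    (hv : valency G v = 2) : ∃ a b, a ≠ b ∧ ∀ y, G.Adj v y ↔ y = a ∨ y = b := by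
  obtain ⟨a, b, hab, hw⟩ := Finset.card_eq_two.1 hv
  exact ⟨a, b, hab, fun y => by simpa using Finset.ext_iff.1 hw y⟩

theorem valency_eq_one {V : Type*} [Fintype V] (G : SimpleGraph V) (v a : V)
    (h : ∀ y, G.Adj v y ↔ y = a) : valency G v = 1 := by
  rw [valency, Finset.card_eq_one]
  exact ⟨a, by ext y; simp [h]⟩

theorem valency_eq_two {V : Type*} [Fintype V] (G : SimpleGraph V) (v a b : V)
    (hab : a ≠ b) (h : ∀ y, G.Adj v y ↔ y = a ∨ y = b) : valency G v = 2 := by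
  rw [valency, Finset.card_eq_two]
  exact ⟨a, b, hab, by ext y; simp [h]⟩

theorem delVert_connected_of_valency_one {V : Type*} [Fintype V] (G : SimpleGraph V)
    (hG : G.Connected) (v : V) (hv : valency G v = 1) : (delVert G v).Connected := by
  have h : G.degree v = 1 := by
    rw [← SimpleGraph.card_neighborFinset_eq_degree, SimpleGraph.neighborFinset_eq_filter]
    exact hv
  exact hG.induce_compl_singleton_of_degree_eq_one h

theorem exists_delVert_connected {V : Type*} [Fintype V] (G : SimpleGraph V)
    (hG : G.Connected) (hn : 2 ≤ Fintype.card V) : ∃ v, (delVert G v).Connected := by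
  have : Nontrivial V := Fintype.one_lt_card_iff_nontrivial.1 hn
  exact hG.exists_connected_induce_compl_singleton_of_finite_nontrivial

theorem pairDistSum_le_of_connected (m : ℕ) : ∀ (V : Type*) [Fintype V] (G : SimpleGraph V),
    G.Connected → Fintype.card V = m →
    3 * pairDistSum G ≤ (m : ℤ) * (m - 1) * (m + 1) := by
  induction m with
  | zero =>
    intro V _ G _ h
    have := Fintype.card_eq_zero_iff.1 h
    simp [pairDistSum]
  | succ m ih =>
    intro V _ G hG h
    by_cases hm : m = 0
    · subst hm
      have : Subsingleton V := Fintype.card_le_one_iff_subsingleton.1 (by omega)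
      have h0 : pairDistSum G = 0 := by
        refine Finset.sum_eq_zero fun u _ => Finset.sum_eq_zero fun v _ => ?_
        rw [Subsingleton.elim u v]; simp
      simp [h0]
    · obtain ⟨v, hv⟩ := exists_delVert_connected G hG (by omega)
      have h1 := ih _ (delVert G v) hv (by have := card_ne_add_one v; omega)
      have h2 := pairDistSum_le_delVert G v hv
      have h3 := distSum_le_of_connected G hG v
      rw [h] at h3
      push_cast at h3 ⊢
      linarith

theorem three_le_card_of_unicyclic {V : Type*} [Fintype V] (G : SimpleGraph V)
    (hG : G.Connected) (hs : 2 * Fintype.card V ≤ ∑ v, valency G v) : 3 ≤ Fintype.card V := by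
  have hle : ∀ v : V, valency G v ≤ Fintype.card V - 1 := by
    intro v
    have hsub : (univ.filter fun y => G.Adj v y) ⊆ univ.erase v := by
      intro y hy
      have := (Finset.mem_filter.1 hy).2.ne'
      simp [this]
    have := Finset.card_le_card hsub
    rwa [Finset.card_erase_of_mem (Finset.mem_univ _), Finset.card_univ] at this
  have h := Finset.sum_le_sum (s := univ) fun v _ => hle v
  simp only [sum_const, Finset.card_univ, smul_eq_mul] at h
  have hpos : 0 < Fintype.card V := Fintype.card_pos_iff.2 hG.nonempty
  have h2 : Fintype.card V * 2 ≤ Fintype.card V * (Fintype.card V - 1) := by omega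
  have := Nat.le_of_mul_le_mul_left h2 hpos
  omega

theorem distSum_le_of_unicyclic (m : ℕ) : ∀ (V : Type*) [Fintype V] (G : SimpleGraph V) (w : V),
    G.Connected → Fintype.card V = m → ∑ v, valency G v = 2 * m → 3 ≤ m →
    2 * distSum G w ≤ (m : ℤ) * (m - 1) - 2 := by
  induction m with
  | zero => intro V _ G w _ _ _ h; omega
  | succ m ih =>
    intro V _ G w hG h hs hm
    have hp := valency_pos G hG (by omega) w
    by_cases h2 : 2 ≤ valency G w
    · have h1 := distSum_le_of_two_le_valency G hG w h2
      rw [h] at h1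
      push_cast at h1 ⊢
      have : (2 : ℤ) ≤ m := by exact_mod_cast (by omega : 2 ≤ m)
      nlinarith
    · have hv : valency G w = 1 := by omega
      have hc := delVert_connected_of_valency_one G hG w hv
      obtain ⟨w', hw'⟩ := exists_unique_neighbor G w hv
      have hcard := card_ne_add_one w
      have hsum := sum_valency_delVert G w
      have h3m := three_le_card_of_unicyclic (delVert G w) hc (by omega)
      have h1 := ih _ (delVert G w) w' hc (by omega) (by omega) (by omega)
      have h3 := distSum_le_delVert G hG w w' ((hw' _).2 rfl) hc
      rw [h] at h3
      push_cast at h3 ⊢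
      linarith

theorem pairDistSum_le_of_unicyclic (m : ℕ) : ∀ (V : Type*) [Fintype V] (G : SimpleGraph V),
    G.Connected → Fintype.card V = m → ∑ v, valency G v = 2 * m →
    3 * pairDistSum G ≤ (m : ℤ) * (m - 1) * (m - 2) + 3 * ((m : ℤ) ^ 2 - 3 * m + 4) := by
  induction m with
  | zero =>
    intro V _ G hG h
    exact absurd (Fintype.card_pos_iff.2 hG.nonempty) (by omega)
  | succ m ih =>
    intro V _ G hG h hs
    have hm := three_le_card_of_unicyclic G hG (by omega)
    by_cases hv : ∃ v, valency G v = 1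
    · obtain ⟨v, hv⟩ := hv
      have hc := delVert_connected_of_valency_one G hG v hv
      have hcard := card_ne_add_one v
      have hsum := sum_valency_delVert G v
      have h1 := ih _ (delVert G v) hc (by omega) (by omega)
      have h2 := pairDistSum_le_delVert G v hc
      have h3 := distSum_le_of_unicyclic (m + 1) V G v hG h hs (by omega)
      push_cast at h3 ⊢
      linarith
    · obtain ⟨v, hc⟩ := exists_delVert_connected G hG (by omega)
      have hcard := card_ne_add_one v
      have hp := valency_pos G hG (by omega) v
      have hne : valency G v ≠ 1 := fun h => hv ⟨v, h⟩
      have h1 := pairDistSum_le_of_connected m _ (delVert G v) hc (by omega)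
      have h2 := pairDistSum_le_delVert G v hc
      have h3 := distSum_le_of_two_le_valency G hG v (by omega)
      rw [h] at h3
      push_cast at h3 ⊢
      linarith

/-- A connected graph with a cycle in which all but at most two vertices have two neighbours
has a non-cut vertex with two neighbours. -/
theorem exists_valency_two_delVert_connected {V : Type*} [Fintype V] (G : SimpleGraph V)
    (hG : G.Connected) (hs : 2 * Fintype.card V ≤ ∑ v, valency G v)
    (hdeg : (univ.filter fun v => valency G v ≠ 2).card ≤ 2) :
    ∃ y, valency G y = 2 ∧ (delVert G y).Connected := by
  have hcyc : ¬ G.IsAcyclic := by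
    intro hac
    have h1 := (SimpleGraph.isTree_iff_connected_and_card.1 ⟨hG, hac⟩).2
    rw [sum_valency_eq] at hs
    rw [Nat.card_eq_fintype_card (α := V), Nat.card_coe_set_eq] at h1
    omega
  simp only [SimpleGraph.IsAcyclic, not_forall, not_not] at hcyc
  obtain ⟨u, c, hc⟩ := hcyc
  have hsupp : ∃ y ∈ c.support, valency G y = 2 := by
    by_contra hno
    push Not at hno
    have hsub : c.support.tail.toFinset ⊆ univ.filter fun v => valency G v ≠ 2 := by
      intro y hy
      rw [List.mem_toFinset] at hy
      simp [hno y (List.mem_of_mem_tail hy)]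
    have h1 := Finset.card_le_card hsub
    rw [List.toFinset_card_of_nodup hc.support_nodup] at h1
    have h2 := hc.three_le_length
    simp only [List.length_tail, SimpleGraph.Walk.length_support] at h1
    omega
  obtain ⟨y, hy, hy2⟩ := hsupp
  refine ⟨y, hy2, ?_⟩
  have hc' := hc.rotate hy
  obtain ⟨z, hyz, q, hq⟩ : ∃ z, ∃ h : G.Adj y z, ∃ q, c.rotate y hy = SimpleGraph.Walk.cons h q := by
    cases hr : c.rotate y hy with
    | nil => rw [hr] at hc'; exact absurd hc' (by simp)
    | cons h q => exact ⟨_, h, q, rfl⟩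
  have hnb : ¬ G.IsBridge s(y, z) := by
    rw [SimpleGraph.isBridge_iff_forall_cycle_notMem ((SimpleGraph.mem_edgeSet G).2 hyz)]
    push Not
    exact ⟨y, c.rotate y hy, hc', by rw [hq]; simp⟩
  have hcon := hG.connected_delete_edge_of_not_isBridge hnb
  obtain ⟨a, b, hab, hN⟩ := exists_two_neighbors G y hy2
  have hval : valency (G.deleteEdges {s(y, z)}) y = 1 := by
    have hz := (hN z).1 hyz
    have key : ∀ t, (G.deleteEdges {s(y, z)}).Adj y t ↔ (t = a ∨ t = b) ∧ t ≠ z := by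
      intro t
      rw [SimpleGraph.deleteEdges_adj, hN]
      simp
      grind
    rcases hz with rfl | rfl
    · exact valency_eq_one _ y b fun t => by rw [key]; grind
    · exact valency_eq_one _ y a fun t => by rw [key]; grind
  refine (delVert_connected_of_valency_one _ hcon y hval).mono ?_
  intro s t hst
  exact (delVert_adj G y s t).2
    (SimpleGraph.deleteEdges_le (G := G) {s(y, z)} ((delVert_adj _ _ _ _).1 hst))

end Bounds

section Explicit

theorem dist_map_le {V W : Type*} {G : SimpleGraph V} {H : SimpleGraph W} (f : G →g H)
    (hG : G.Connected) (a b : V) : H.dist (f a) (f b) ≤ G.dist a b := by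
  obtain ⟨p, hp⟩ := hG.exists_walk_length_eq_dist a b
  have := SimpleGraph.dist_le (p.map f)
  rwa [SimpleGraph.Walk.length_map, hp] at this

theorem dist_iso {V W : Type*} {G : SimpleGraph V} {H : SimpleGraph W} (e : G ≃g H)
    (hG : G.Connected) (a b : V) : H.dist (e a) (e b) = G.dist a b := by
  refine le_antisymm (dist_map_le e.toHom hG a b) ?_
  have h := dist_map_le e.symm.toHom (e.connected_iff.1 hG) (e a) (e b)
  simpa using h

theorem distSum_iso {V W : Type*} [Fintype V] [Fintype W] {G : SimpleGraph V} {H : SimpleGraph W}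
    (e : G ≃g H) (hG : G.Connected) (a : V) : distSum H (e a) = distSum G a := by
  rw [distSum, ← e.toEquiv.sum_comp]
  refine Finset.sum_congr rfl fun b _ => ?_
  exact_mod_cast dist_iso e hG a b

theorem pairDistSum_iso {V W : Type*} [Fintype V] [Fintype W] {G : SimpleGraph V}
    {H : SimpleGraph W} (e : G ≃g H) (hG : G.Connected) : pairDistSum H = pairDistSum G := by
  rw [pairDistSum, ← e.toEquiv.sum_comp]
  exact Finset.sum_congr rfl fun b _ => distSum_iso e hG b

/-- A function that behaves like a distance with respect to the edges is the distance. -/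
theorem dist_eq_of_potential {V : Type*} (G : SimpleGraph V) (g : V → V → ℕ)
    (h0 : ∀ u, g u u = 0) (h0' : ∀ u v, g u v = 0 → u = v)
    (hadj : ∀ u v w, G.Adj v w → g u v ≤ g u w + 1)
    (h1 : ∀ u v, g u v = 1 → G.Adj v u)
    (h2 : ∀ u v k, g u v = k + 2 → ∃ w, G.Adj v w ∧ g u w = k + 1) (u v : V) :
    G.dist u v = g u v := by
  have hle : ∀ k v, g u v = k → ∃ p : G.Walk v u, p.length = k := by
    intro k
    induction k with
    | zero =>
      intro v h
      rw [h0' u v h]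
      exact ⟨SimpleGraph.Walk.nil, rfl⟩
    | succ k ih =>
      intro v h
      cases k with
      | zero => exact ⟨(h1 u v h).toWalk, by simp⟩
      | succ k =>
        obtain ⟨w, hw, hk⟩ := h2 u v k h
        obtain ⟨p, hp⟩ := ih w hk
        exact ⟨SimpleGraph.Walk.cons hw p, by simp [hp]⟩
  have hge : ∀ (v w : V) (p : G.Walk v w), g u v ≤ g u w + p.length := by
    intro v w p
    induction p with
    | nil => simp
    | cons h q ih =>
      have := hadj u _ _ h
      simp only [SimpleGraph.Walk.length_cons]
      omega
  obtain ⟨p, hp⟩ := hle _ v rfl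
  rw [SimpleGraph.dist_comm]
  refine le_antisymm (hp ▸ SimpleGraph.dist_le p) ?_
  obtain ⟨q, hq⟩ := SimpleGraph.Reachable.exists_walk_length_eq_dist ⟨p⟩
  have := hge v u q
  rw [h0 u] at this
  omega

/-- The absolute difference of two natural numbers. -/
def gap (a b : ℕ) : ℕ := (a - b) + (b - a)

/-- The position of a vertex of `B(n,s)` along its longest path. -/
def posB (n s i : ℕ) : ℕ := if i = n - 1 then n - 3 - s else i

/-- The position of a vertex of `B_n^{3,3}` along its longest path. -/
def posB33 (n i : ℕ) : ℕ := if i = 0 then 1 else if i = n - 1 then n - 2 else i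

/-- The position of a vertex of `B_n^{(1)}` along its longest path. -/
def posBn1 (n i : ℕ) : ℕ := if n - 3 ≤ i then n - 3 else i

/-- The distances in a graph whose edges join vertices at consecutive heights, or distinct
vertices at the same height unless they are related by `R`. -/
theorem dist_eq_of_height {V : Type*} (G : SimpleGraph V) (h : V → ℕ) (R : V → V → Prop)
    (hA : ∀ v w, G.Adj v w ↔ gap (h v) (h w) = 1 ∨ (h v = h w ∧ v ≠ w ∧ ¬ R v w))
    (hfill : ∀ u v k, h u ≤ k → k ≤ h v → ∃ w, h w = k)
    (hR : ∀ u v, u ≠ v → h u = h v → R u v → ∃ w, gap (h u) (h w) = 1) (u v : V) :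
    G.dist u v = gap (h u) (h v) + if h u = h v ∧ u ≠ v then (if R u v then 2 else 1) else 0 := by
  refine dist_eq_of_potential G (fun u v => gap (h u) (h v) +
    if h u = h v ∧ u ≠ v then (if R u v then 2 else 1) else 0) ?_ ?_ ?_ ?_ ?_ u v
  · intro u; simp [gap]
  · intro u v hg
    by_contra hne
    simp only [gap] at hg
    by_cases h1 : h u = h v
    · simp only [h1, hne, ne_eq, not_false_eq_true, and_self, if_true] at hg
      split_ifs at hg
    · omega
  · intro u v w hvw
    rcases (hA v w).1 hvw with hg | ⟨h1, h2, h3⟩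
    · simp only [gap] at hg ⊢
      by_cases h1 : h u = h v
      · have h2 : ¬ (h u = h w ∧ u ≠ w) := by omega
        rw [if_neg h2]
        have : h u - h w + (h w - h u) = 1 := by omega
        rw [this]
        split_ifs <;> omega
      · rw [if_neg (by tauto)]; omega
    · rw [h1]
      by_cases h4 : h u = h w
      · by_cases h5 : u = w
        · subst h5
          have h6 : ¬ R u v := by
            intro h6
            rcases (hA u v).1 hvw.symm with h7 | h7
            · simp only [gap] at h7; omega
            · exact h7.2.2 h6
          simp only [gap, h6, if_false]
          split_ifs <;> omega
        · simp only [h4, h5, ne_eq, not_false_eq_true, and_self, if_true]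
          split_ifs <;> omega
      · simp [h4]
  · intro u v hg
    rw [SimpleGraph.adj_comm, hA]
    simp only [gap] at hg ⊢
    split_ifs at hg with h1 h2
    · omega
    · exact Or.inr ⟨h1.1, h1.2, h2⟩
    · left; omega
  · intro u v k hg
    by_cases h1 : h u = h v
    · by_cases h2 : u = v ∨ ¬ R u v
      · simp only [gap] at hg
        split_ifs at hg <;> first | omega | tauto
      · push Not at h2
        obtain ⟨w, hw⟩ := hR u v h2.1 h1 h2.2
        refine ⟨w, (hA v w).2 (Or.inl (by rw [← h1]; exact hw)), ?_⟩
        have : h u ≠ h w := by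
          simp only [gap] at hw; omega
        simp only [this, false_and, if_false, hw]
        rw [if_pos ⟨h1, h2.1⟩, if_pos h2.2] at hg
        simp only [gap] at hg
        omega
    · simp only [gap, h1, false_and, if_false] at hg
      rcases lt_or_gt_of_ne h1 with hlt | hlt
      · obtain ⟨w, hw⟩ := hfill u v (h v - 1) (by omega) (by omega)
        refine ⟨w, (hA v w).2 (Or.inl (by simp only [gap]; omega)), ?_⟩
        have : h u ≠ h w := by omega
        simp only [gap, this, false_and, if_false]; omega
      · obtain ⟨w, hw⟩ := hfill v u (h v + 1) (by omega) (by omega)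
        refine ⟨w, (hA v w).2 (Or.inl (by simp only [gap]; omega)), ?_⟩
        have : h u ≠ h w := by omega
        simp only [gap, this, false_and, if_false]; omega

theorem dist_Bgraph (n s : ℕ) (hn : s + 4 ≤ n) (i j : Fin n) :
    (Bgraph n s).dist i j = gap (posB n s i) (posB n s j) +
      if posB n s i = posB n s j ∧ i ≠ j then 1 else 0 := by
  have hp : ∀ i, (i = n - 1 ∧ posB n s i = n - 3 - s) ∨ (i ≠ n - 1 ∧ posB n s i = i) := by
    intro i; unfold posB; split_ifs <;> simp_all
  have := dist_eq_of_height (Bgraph n s) (fun i => posB n s i) (fun _ _ => False) ?_ ?_ ?_ i j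
  · simpa using this
  · rintro ⟨u, hu⟩ ⟨v, hv⟩
    simp only [Bgraph, fromRel_adj, ne_eq, Fin.mk.injEq, not_false_eq_true, and_true, gap]
    obtain ⟨m, rfl⟩ : ∃ m, n = m + s + 4 := ⟨n - s - 4, by omega⟩
    rcases hp u with ⟨h1, h2⟩ | ⟨h1, h2⟩ <;> rcases hp v with ⟨h3, h4⟩ | ⟨h3, h4⟩ <;>
      rw [h2, h4] <;> constructor <;> intro h <;> omega
  · rintro ⟨u, hu⟩ ⟨v, hv⟩ k h1 h2
    have h3 : k < n - 1 := by
      rcases hp v with h | h <;> simp only at h2 <;> omega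
    refine ⟨⟨k, by omega⟩, ?_⟩
    simp only [posB]
    rw [if_neg (by omega)]
  · simp

theorem dist_B33 (n : ℕ) (hn : 5 ≤ n) (i j : Fin n) :
    (B33 n).dist i j = gap (posB33 n i) (posB33 n j) +
      if posB33 n i = posB33 n j ∧ i ≠ j then 1 else 0 := by
  have hp : ∀ i, (i = 0 ∧ posB33 n i = 1) ∨ (i = n - 1 ∧ posB33 n i = n - 2) ∨
      (i ≠ 0 ∧ i ≠ n - 1 ∧ posB33 n i = i) := by
    intro i; unfold posB33; split_ifs <;> simp_all
  have := dist_eq_of_height (B33 n) (fun i => posB33 n i) (fun _ _ => False) ?_ ?_ ?_ i j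
  · simpa using this
  · rintro ⟨u, hu⟩ ⟨v, hv⟩
    simp only [B33, fromRel_adj, ne_eq, Fin.mk.injEq, not_false_eq_true, and_true, gap]
    obtain ⟨m, rfl⟩ : ∃ m, n = m + 5 := ⟨n - 5, by omega⟩
    rcases hp u with ⟨h1, h2⟩ | ⟨h1, h2⟩ | ⟨h0, h1, h2⟩ <;>
      rcases hp v with ⟨h3, h4⟩ | ⟨h3, h4⟩ | ⟨h5, h3, h4⟩ <;>
      rw [h2, h4] <;> constructor <;> intro h <;> omega
  · rintro ⟨u, hu⟩ ⟨v, hv⟩ k h1 h2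
    have h3 : k < n - 1 := by
      rcases hp v with h | h | h <;> simp only at h2 <;> omega
    have h4 : 0 < k := by
      rcases hp u with h | h | h <;> simp only at h1 <;> omega
    refine ⟨⟨k, by omega⟩, ?_⟩
    simp only [posB33]
    rw [if_neg (by omega), if_neg (by omega)]
  · simp

theorem dist_Bn1 (n : ℕ) (hn : 4 ≤ n) (i j : Fin n) :
    (Bn1 n).dist i j = gap (posBn1 n i) (posBn1 n j) +
      if posBn1 n i = posBn1 n j ∧ i ≠ j then
        if i.val ≠ n - 3 ∧ j.val ≠ n - 3 then 2 else 1 else 0 := by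
  have hp : ∀ i, (n - 3 ≤ i ∧ posBn1 n i = n - 3) ∨ (i < n - 3 ∧ posBn1 n i = i) := by
    intro i; unfold posBn1; split_ifs with h
    · exact Or.inl ⟨h, rfl⟩
    · exact Or.inr ⟨not_le.1 h, rfl⟩
  have := dist_eq_of_height (Bn1 n) (fun i => posBn1 n i)
    (fun i j => i.val ≠ n - 3 ∧ j.val ≠ n - 3) ?_ ?_ ?_ i j
  · convert this
  · rintro ⟨u, hu⟩ ⟨v, hv⟩
    simp only [Bn1, fromRel_adj, ne_eq, Fin.mk.injEq, gap]
    obtain ⟨m, rfl⟩ : ∃ m, n = m + 4 := ⟨n - 4, by omega⟩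
    have hq : ∀ i < m + 4, (i < m + 1 ∧ posBn1 (m + 4) i = i) ∨
        (i = m + 1 ∧ posBn1 (m + 4) i = m + 1) ∨ (i = m + 2 ∧ posBn1 (m + 4) i = m + 1) ∨
        (i = m + 3 ∧ posBn1 (m + 4) i = m + 1) := by
      intro i hi
      rcases hp i with h | h <;> omega
    rcases hq u hu with ⟨h1, h2⟩ | ⟨rfl, h2⟩ | ⟨rfl, h2⟩ | ⟨rfl, h2⟩ <;>
      rcases hq v hv with ⟨h3, h4⟩ | ⟨rfl, h4⟩ | ⟨rfl, h4⟩ | ⟨rfl, h4⟩ <;>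
      simp only [h2, h4] <;> clear h2 h4 hp hq <;> simp <;> omega
  · rintro ⟨u, hu⟩ ⟨v, hv⟩ k h1 h2
    have h3 : k ≤ n - 3 := by
      rcases hp v with h | h <;> simp only at h2 <;> omega
    refine ⟨⟨k, by omega⟩, ?_⟩
    rcases hp k with h | h <;> simp only <;> omega
  · rintro ⟨u, hu⟩ ⟨v, hv⟩ h1 h2 h3
    refine ⟨⟨n - 4, by omega⟩, ?_⟩
    simp only [ne_eq, Fin.mk.injEq] at h1 h2 h3
    simp only [gap]
    rcases hp u with h | h <;> rcases hp v with h' | h' <;> rcases hp (n - 4) with h'' | h'' <;>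
      omega

end Explicit

section Values

/-- The sum of the distances from `i` to `0, …, k - 1`. -/
def lineSum (k i : ℕ) : ℤ := ∑ j ∈ range k, (gap i j : ℤ)

theorem two_mul_lineSum_of_ge (i : ℕ) : ∀ k ≤ i, 2 * lineSum k i = (k : ℤ) * (2 * i - k + 1) := by
  intro k
  induction k with
  | zero => intro _; simp [lineSum]
  | succ k ih =>
    intro h
    have h1 := ih (by omega)
    rw [lineSum] at h1 ⊢
    have h2 : (gap i k : ℤ) = i - k := by
      unfold gap; omega
    rw [Finset.sum_range_succ, mul_add, h1, h2]
    push_cast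
    ring

theorem two_mul_lineSum (i k : ℕ) (h : i ≤ k) :
    2 * lineSum k i = (i : ℤ) * (i + 1) + (k - 1 - i) * (k - i) := by
  induction k, h using Nat.le_induction with
  | base =>
    rw [two_mul_lineSum_of_ge i i le_rfl]
    ring
  | succ k hk ih =>
    rw [lineSum] at ih ⊢
    have h2 : (gap i k : ℤ) = k - i := by
      unfold gap; omega
    rw [Finset.sum_range_succ, mul_add, ih, h2]
    push_cast
    ring

theorem three_mul_sum_lineSum (k : ℕ) :
    3 * ∑ i ∈ range k, lineSum k i = (k : ℤ) * (k - 1) * (k + 1) := by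
  have h : ∀ l ≤ k, 6 * ∑ i ∈ range l, lineSum k i = (l : ℤ) * (l - 1) * (l + 1) +
      ((k - 1 : ℤ) * k * (k + 1) - (k - 1 - l) * (k - l) * (k + 1 - l)) := by
    intro l
    induction l with
    | zero => intro _; simp
    | succ l ih =>
      intro hl
      have h1 := two_mul_lineSum l k (by omega)
      have h2 := ih (by omega)
      rw [Finset.sum_range_succ]
      push_cast
      linear_combination h2 + 3 * h1
  have := h k le_rfl
  linarith

theorem distSum_Bgraph (k s i : ℕ) (hk : s + 3 ≤ k) (hi : i < k) :
    distSum (Bgraph (k + 1) s) ⟨i, by omega⟩ =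
      lineSum k i + gap i (k - 2 - s) + if i = k - 2 - s then 1 else 0 := by
  have h : distSum (Bgraph (k + 1) s) ⟨i, by omega⟩ =
      ∑ j ∈ range (k + 1), ((gap i (posB (k + 1) s j) : ℤ) +
        if i = posB (k + 1) s j ∧ i ≠ j then 1 else 0) := by
    rw [← Fin.sum_univ_eq_sum_range (fun j => (gap i (posB (k + 1) s j) : ℤ) +
        if i = posB (k + 1) s j ∧ i ≠ j then 1 else 0)]
    refine Finset.sum_congr rfl fun j _ => ?_
    rw [dist_Bgraph (k + 1) s (by omega)]
    have h1 : posB (k + 1) s i = i := by unfold posB; rw [if_neg (by omega)]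
    simp [h1, Fin.ext_iff]
  rw [h, Finset.sum_range_succ, add_assoc]
  congr 1
  · refine Finset.sum_congr rfl fun j hj => ?_
    have h1 : posB (k + 1) s j = j := by
      unfold posB; rw [if_neg (by have := Finset.mem_range.1 hj; omega)]
    simp [h1]
  · have h1 : posB (k + 1) s k = k - 2 - s := by unfold posB; rw [if_pos (by omega)]; omega
    have h2 : i ≠ k := by omega
    simp [h1, h2]

theorem distSum_Bgraph_last (k s : ℕ) (hk : s + 3 ≤ k) :
    distSum (Bgraph (k + 1) s) ⟨k, by omega⟩ = lineSum k (k - 2 - s) + 1 := by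
  have h1 : posB (k + 1) s k = k - 2 - s := by unfold posB; rw [if_pos (by omega)]; omega
  have h : distSum (Bgraph (k + 1) s) ⟨k, by omega⟩ =
      ∑ j ∈ range (k + 1), ((gap (k - 2 - s) (posB (k + 1) s j) : ℤ) +
        if k - 2 - s = posB (k + 1) s j ∧ k ≠ j then 1 else 0) := by
    rw [← Fin.sum_univ_eq_sum_range (fun j => (gap (k - 2 - s) (posB (k + 1) s j) : ℤ) +
        if k - 2 - s = posB (k + 1) s j ∧ k ≠ j then 1 else 0)]
    refine Finset.sum_congr rfl fun j _ => ?_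
    rw [dist_Bgraph (k + 1) s (by omega)]
    simp [h1, Fin.ext_iff]
  rw [h, Finset.sum_range_succ]
  have h3 : ∀ j ∈ range k, ((gap (k - 2 - s) (posB (k + 1) s j) : ℤ) +
      if k - 2 - s = posB (k + 1) s j ∧ k ≠ j then 1 else 0) =
      (gap (k - 2 - s) j : ℤ) + if k - 2 - s = j then 1 else 0 := by
    intro j hj
    have hj := Finset.mem_range.1 hj
    have h2 : posB (k + 1) s j = j := by unfold posB; rw [if_neg (by omega)]
    have h4 : k ≠ j := by omega
    simp [h2, h4]
  rw [Finset.sum_congr rfl h3, Finset.sum_add_distrib, Finset.sum_ite_eq, if_pos (by simp; omega)]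
  simp [h1, gap, lineSum]

theorem pairDistSum_Bgraph (k s : ℕ) (hk : s + 3 ≤ k) :
    3 * pairDistSum (Bgraph (k + 1) s) = (k : ℤ) * (k - 1) * (k + 1) +
      6 * (lineSum k (k - 2 - s) + 1) := by
  have h : pairDistSum (Bgraph (k + 1) s) =
      ∑ i ∈ range (k + 1), (if h : i < k then
        lineSum k i + gap i (k - 2 - s) + (if i = k - 2 - s then 1 else 0) else
        lineSum k (k - 2 - s) + 1) := by
    rw [← Fin.sum_univ_eq_sum_range (fun i => if h : i < k then
        lineSum k i + gap i (k - 2 - s) + (if i = k - 2 - s then 1 else 0) else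
        lineSum k (k - 2 - s) + 1)]
    refine Finset.sum_congr rfl fun i _ => ?_
    by_cases hi : i.val < k
    · simp only [hi, dif_pos]
      exact distSum_Bgraph k s i hk hi
    · have : i = ⟨k, by omega⟩ := Fin.ext (by simp; omega)
      rw [this]
      simp only [lt_irrefl, dif_neg, not_false_eq_true]
      exact distSum_Bgraph_last k s hk
  rw [h, Finset.sum_range_succ]
  have h3 : ∀ i ∈ range k, (if h : i < k then
        lineSum k i + gap i (k - 2 - s) + (if i = k - 2 - s then 1 else 0) else
        lineSum k (k - 2 - s) + 1) = lineSum k i + gap (k - 2 - s) i +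
        if k - 2 - s = i then 1 else 0 := by
    intro i hi
    rw [dif_pos (Finset.mem_range.1 hi)]
    simp [gap, add_comm, eq_comm]
  rw [Finset.sum_congr rfl h3, Finset.sum_add_distrib, Finset.sum_add_distrib,
    Finset.sum_ite_eq, if_pos (by simp; omega), ← lineSum]
  have := three_mul_sum_lineSum k
  simp only [lt_irrefl, dif_neg, not_false_eq_true]
  linarith

theorem distSum_B33 (k i : ℕ) (hk : 3 ≤ k) (hi : i < k) :
    distSum (B33 (k + 2)) ⟨i + 1, by omega⟩ = lineSum k i + (k - 1) +
      (if i = 0 then 1 else 0) + (if i + 1 = k then 1 else 0) := by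
  have h : distSum (B33 (k + 2)) ⟨i + 1, by omega⟩ =
      ∑ j ∈ range (k + 2), ((gap (i + 1) (posB33 (k + 2) j) : ℤ) +
        if i + 1 = posB33 (k + 2) j ∧ i + 1 ≠ j then 1 else 0) := by
    rw [← Fin.sum_univ_eq_sum_range (fun j => (gap (i + 1) (posB33 (k + 2) j) : ℤ) +
        if i + 1 = posB33 (k + 2) j ∧ i + 1 ≠ j then 1 else 0)]
    refine Finset.sum_congr rfl fun j _ => ?_
    rw [dist_B33 (k + 2) (by omega)]
    have h1 : posB33 (k + 2) (i + 1) = i + 1 := by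
      unfold posB33; rw [if_neg (by omega), if_neg (by omega)]
    simp [h1, Fin.ext_iff]
  rw [h, Finset.sum_range_succ, Finset.sum_range_succ']
  have h3 : ∀ j ∈ range k, ((gap (i + 1) (posB33 (k + 2) (j + 1)) : ℤ) +
        if i + 1 = posB33 (k + 2) (j + 1) ∧ i + 1 ≠ j + 1 then 1 else 0) = gap i j := by
    intro j hj
    have hj := Finset.mem_range.1 hj
    have h2 : posB33 (k + 2) (j + 1) = j + 1 := by
      unfold posB33; rw [if_neg (by omega), if_neg (by omega)]
    simp [h2, gap]
  rw [Finset.sum_congr rfl h3, ← lineSum]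
  have h1 : posB33 (k + 2) (k + 1) = k := by
    unfold posB33; rw [if_neg (by omega), if_pos (by omega)]; omega
  have h2 : i ≠ k := by omega
  have h4 : posB33 (k + 2) 0 = 1 := by simp [posB33]
  simp only [h1, h4, gap]
  split_ifs <;> omega

theorem distSum_B33_first (k : ℕ) (hk : 3 ≤ k) :
    distSum (B33 (k + 2)) ⟨0, by omega⟩ = lineSum k 0 + k := by
  have h : distSum (B33 (k + 2)) ⟨0, by omega⟩ =
      ∑ j ∈ range (k + 2), ((gap 1 (posB33 (k + 2) j) : ℤ) +
        if 1 = posB33 (k + 2) j ∧ 0 ≠ j then 1 else 0) := by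
    rw [← Fin.sum_univ_eq_sum_range (fun j => (gap 1 (posB33 (k + 2) j) : ℤ) +
        if 1 = posB33 (k + 2) j ∧ 0 ≠ j then 1 else 0)]
    refine Finset.sum_congr rfl fun j _ => ?_
    rw [dist_B33 (k + 2) (by omega)]
    have h1 : posB33 (k + 2) 0 = 1 := by simp [posB33]
    simp [h1, Fin.ext_iff]
  rw [h, Finset.sum_range_succ, Finset.sum_range_succ']
  have h3 : ∀ j ∈ range k, ((gap 1 (posB33 (k + 2) (j + 1)) : ℤ) +
        if 1 = posB33 (k + 2) (j + 1) ∧ 0 ≠ j + 1 then 1 else 0) =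
        gap 0 j + if 0 = j then 1 else 0 := by
    intro j hj
    have hj := Finset.mem_range.1 hj
    have h2 : posB33 (k + 2) (j + 1) = j + 1 := by
      unfold posB33; rw [if_neg (by omega), if_neg (by omega)]
    simp only [h2, gap]
    split_ifs <;> omega
  rw [Finset.sum_congr rfl h3, Finset.sum_add_distrib, Finset.sum_ite_eq,
    if_pos (by simp; omega), ← lineSum]
  have h1 : posB33 (k + 2) (k + 1) = k := by
    unfold posB33; rw [if_neg (by omega), if_pos (by omega)]; omega
  have h4 : posB33 (k + 2) 0 = 1 := by simp [posB33]
  simp only [h1, h4, gap]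
  split_ifs <;> omega

theorem distSum_B33_last (k : ℕ) (hk : 3 ≤ k) :
    distSum (B33 (k + 2)) ⟨k + 1, by omega⟩ = lineSum k (k - 1) + k := by
  have h1 : posB33 (k + 2) (k + 1) = k := by
    unfold posB33; rw [if_neg (by omega), if_pos (by omega)]; omega
  have h : distSum (B33 (k + 2)) ⟨k + 1, by omega⟩ =
      ∑ j ∈ range (k + 2), ((gap k (posB33 (k + 2) j) : ℤ) +
        if k = posB33 (k + 2) j ∧ k + 1 ≠ j then 1 else 0) := by
    rw [← Fin.sum_univ_eq_sum_range (fun j => (gap k (posB33 (k + 2) j) : ℤ) +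
        if k = posB33 (k + 2) j ∧ k + 1 ≠ j then 1 else 0)]
    refine Finset.sum_congr rfl fun j _ => ?_
    rw [dist_B33 (k + 2) (by omega)]
    simp [h1, Fin.ext_iff]
  rw [h, Finset.sum_range_succ, Finset.sum_range_succ']
  have h3 : ∀ j ∈ range k, ((gap k (posB33 (k + 2) (j + 1)) : ℤ) +
        if k = posB33 (k + 2) (j + 1) ∧ k + 1 ≠ j + 1 then 1 else 0) =
        gap (k - 1) j + if k - 1 = j then 1 else 0 := by
    intro j hj
    have hj := Finset.mem_range.1 hj
    have h2 : posB33 (k + 2) (j + 1) = j + 1 := by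
      unfold posB33; rw [if_neg (by omega), if_neg (by omega)]
    simp only [h2, gap]
    split_ifs <;> omega
  rw [Finset.sum_congr rfl h3, Finset.sum_add_distrib, Finset.sum_ite_eq,
    if_pos (by simp; omega), ← lineSum]
  have h4 : posB33 (k + 2) 0 = 1 := by simp [posB33]
  simp only [h1, h4, gap]
  split_ifs <;> omega

theorem pairDistSum_B33 (k : ℕ) (hk : 3 ≤ k) :
    3 * pairDistSum (B33 (k + 2)) = (k : ℤ) * (k - 1) * (k + 1) +
      3 * ((k : ℤ) * (k - 1) + k * (k - 1) + 2 * k + 2) := by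
  have h : pairDistSum (B33 (k + 2)) =
      ∑ i ∈ range (k + 2), (if h : i < k + 2 then distSum (B33 (k + 2)) ⟨i, h⟩
        else 0) := by
    rw [← Fin.sum_univ_eq_sum_range (fun i => if h : i < k + 2 then distSum (B33 (k + 2)) ⟨i, h⟩
        else 0)]
    refine Finset.sum_congr rfl fun i _ => ?_
    simp only [i.2, dif_pos]
    rfl
  rw [h, Finset.sum_range_succ, Finset.sum_range_succ',
    dif_pos (by omega), dif_pos (by omega), distSum_B33_first k hk, distSum_B33_last k hk]
  have h3 : ∀ i ∈ range k, (if h : i + 1 < k + 2 then distSum (B33 (k + 2)) ⟨i + 1, h⟩ else 0) =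
      lineSum k i + (k - 1) + (if 0 = i then 1 else 0) + (if k - 1 = i then 1 else 0) := by
    intro i hi
    have hi := Finset.mem_range.1 hi
    rw [dif_pos (by omega), distSum_B33 k i hk hi]
    congr 2
    · simp only [eq_comm]
    · exact propext (by omega)
  rw [Finset.sum_congr rfl h3, Finset.sum_add_distrib, Finset.sum_add_distrib,
    Finset.sum_add_distrib, Finset.sum_ite_eq, Finset.sum_ite_eq, if_pos (by simp; omega),
    if_pos (by simp; omega)]
  have h4 := three_mul_sum_lineSum k
  have h5 := two_mul_lineSum 0 k (by omega)
  have h6 := two_mul_lineSum (k - 1) k (by omega)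
  rw [Nat.cast_sub (by omega)] at h6
  simp only [Finset.sum_const, Finset.card_range, nsmul_eq_mul]
  push_cast at h5 h6
  linarith

theorem distSum_Bn1 (k i : ℕ) (hk : 2 ≤ k) (hi : i < k) :
    distSum (Bn1 (k + 2)) ⟨i, by omega⟩ = lineSum k i + 2 * gap (k - 1) i +
      2 * (if k - 1 = i then 1 else 0) := by
  have hq : ∀ i < k, posBn1 (k + 2) i = i := by
    intro i hi
    unfold posBn1; split_ifs <;> omega
  have hq' : ∀ i, k ≤ i → posBn1 (k + 2) i = k - 1 := by
    intro i hi
    unfold posBn1; split_ifs <;> omega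
  have h : distSum (Bn1 (k + 2)) ⟨i, by omega⟩ =
      ∑ j ∈ range (k + 2), ((gap i (posBn1 (k + 2) j) : ℤ) +
        if i = posBn1 (k + 2) j ∧ i ≠ j then
          if i ≠ k + 2 - 3 ∧ j ≠ k + 2 - 3 then 2 else 1 else 0) := by
    rw [← Fin.sum_univ_eq_sum_range (fun j => (gap i (posBn1 (k + 2) j) : ℤ) +
        if i = posBn1 (k + 2) j ∧ i ≠ j then
          if i ≠ k + 2 - 3 ∧ j ≠ k + 2 - 3 then 2 else 1 else 0)]
    refine Finset.sum_congr rfl fun j _ => ?_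
    rw [dist_Bn1 (k + 2) (by omega)]
    simp [hq i hi, Fin.ext_iff]
  rw [h, Finset.sum_range_succ, Finset.sum_range_succ]
  have h3 : ∀ j ∈ range k, ((gap i (posBn1 (k + 2) j) : ℤ) +
        if i = posBn1 (k + 2) j ∧ i ≠ j then
          if i ≠ k + 2 - 3 ∧ j ≠ k + 2 - 3 then 2 else 1 else 0) = gap i j := by
    intro j hj
    simp [hq j (Finset.mem_range.1 hj)]
  rw [Finset.sum_congr rfl h3, ← lineSum, hq' k le_rfl, hq' (k + 1) (by omega)]
  simp only [gap]
  split_ifs <;> omega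

theorem distSum_Bn1_last (k i : ℕ) (hk : 2 ≤ k) (hi : i < 2) :
    distSum (Bn1 (k + 2)) ⟨k + i, by omega⟩ = lineSum k (k - 1) + 3 := by
  have hq : ∀ i < k, posBn1 (k + 2) i = i := by
    intro i hi
    unfold posBn1; split_ifs <;> omega
  have hq' : ∀ i, k ≤ i → posBn1 (k + 2) i = k - 1 := by
    intro i hi
    unfold posBn1; split_ifs <;> omega
  have h : distSum (Bn1 (k + 2)) ⟨k + i, by omega⟩ =
      ∑ j ∈ range (k + 2), ((gap (k - 1) (posBn1 (k + 2) j) : ℤ) +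
        if k - 1 = posBn1 (k + 2) j ∧ k + i ≠ j then
          if k + i ≠ k + 2 - 3 ∧ j ≠ k + 2 - 3 then 2 else 1 else 0) := by
    rw [← Fin.sum_univ_eq_sum_range (fun j => (gap (k - 1) (posBn1 (k + 2) j) : ℤ) +
        if k - 1 = posBn1 (k + 2) j ∧ k + i ≠ j then
          if k + i ≠ k + 2 - 3 ∧ j ≠ k + 2 - 3 then 2 else 1 else 0)]
    refine Finset.sum_congr rfl fun j _ => ?_
    rw [dist_Bn1 (k + 2) (by omega)]
    simp [hq' (k + i) (by omega), Fin.ext_iff]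
  rw [h, Finset.sum_range_succ, Finset.sum_range_succ]
  have h3 : ∀ j ∈ range k, ((gap (k - 1) (posBn1 (k + 2) j) : ℤ) +
        if k - 1 = posBn1 (k + 2) j ∧ k + i ≠ j then
          if k + i ≠ k + 2 - 3 ∧ j ≠ k + 2 - 3 then 2 else 1 else 0) =
        gap (k - 1) j + if k - 1 = j then 1 else 0 := by
    intro j hj
    have hj := Finset.mem_range.1 hj
    rw [hq j hj]
    congr 1
    split_ifs <;> omega
  rw [Finset.sum_congr rfl h3, Finset.sum_add_distrib, Finset.sum_ite_eq,
    if_pos (by simp; omega), ← lineSum, hq' k le_rfl, hq' (k + 1) (by omega)]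
  simp only [gap]
  rcases (by omega : i = 0 ∨ i = 1) with rfl | rfl
  · have h1 : k + 0 ≠ k + 2 - 3 ∧ k + 1 ≠ k + 2 - 3 := by omega
    simp
    omega
  · have h1 : k + 1 ≠ k + 2 - 3 ∧ k ≠ k + 2 - 3 := by omega
    simp
    omega

theorem pairDistSum_Bn1 (k : ℕ) (hk : 2 ≤ k) :
    3 * pairDistSum (Bn1 (k + 2)) = (k : ℤ) * (k - 1) * (k + 1) +
      3 * (2 * (k : ℤ) * (k - 1) + 8) := by
  have h : pairDistSum (Bn1 (k + 2)) =
      ∑ i ∈ range (k + 2), (if h : i < k + 2 then distSum (Bn1 (k + 2)) ⟨i, h⟩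
        else 0) := by
    rw [← Fin.sum_univ_eq_sum_range (fun i => if h : i < k + 2 then distSum (Bn1 (k + 2)) ⟨i, h⟩
        else 0)]
    refine Finset.sum_congr rfl fun i _ => ?_
    simp only [i.2, dif_pos]
    rfl
  have h0 : distSum (Bn1 (k + 2)) ⟨k, by omega⟩ = lineSum k (k - 1) + 3 :=
    distSum_Bn1_last k 0 hk (by omega)
  rw [h, Finset.sum_range_succ, Finset.sum_range_succ,
    dif_pos (by omega), dif_pos (by omega), h0, distSum_Bn1_last k 1 hk (by omega)]
  have h3 : ∀ i ∈ range k, (if h : i < k + 2 then distSum (Bn1 (k + 2)) ⟨i, h⟩ else 0) =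
      lineSum k i + 2 * gap (k - 1) i + 2 * (if k - 1 = i then 1 else 0) := by
    intro i hi
    have hi := Finset.mem_range.1 hi
    rw [dif_pos (by omega), distSum_Bn1 k i hk hi]
  rw [Finset.sum_congr rfl h3, Finset.sum_add_distrib, Finset.sum_add_distrib,
    ← Finset.mul_sum, ← Finset.mul_sum, Finset.sum_ite_eq, if_pos (by simp; omega), ← lineSum]
  have h4 := three_mul_sum_lineSum k
  have h6 := two_mul_lineSum (k - 1) k (by omega)
  rw [Nat.cast_sub (by omega)] at h6
  push_cast at h6
  linear_combination h4 + 6 * h6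

end Values

section AdjInd

variable {V : Type*}

/-- The indicator of adjacency. -/
def adjInd (G : SimpleGraph V) (x y : V) : ℕ := if G.Adj x y then 1 else 0

theorem adjInd_comm (G : SimpleGraph V) (x y : V) : adjInd G x y = adjInd G y x := by
  by_cases h : G.Adj x y
  · simp [adjInd, h, h.symm]
  · simp [adjInd, h, mt (fun k : G.Adj y x => k.symm) h]

theorem adjInd_self (G : SimpleGraph V) (x : V) : adjInd G x x = 0 := by simp [adjInd]

theorem adjInd_le_one (G : SimpleGraph V) (x y : V) : adjInd G x y ≤ 1 := by
  unfold adjInd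
  split_ifs <;> omega

theorem adjInd_eq_zero (G : SimpleGraph V) {x y : V} (h : ¬ G.Adj x y) : adjInd G x y = 0 :=
  if_neg h

theorem adjInd_eq_one (G : SimpleGraph V) {x y : V} (h : G.Adj x y) : adjInd G x y = 1 :=
  if_pos h

end AdjInd

section Attach

variable {V : Type*} [Fintype V]

/-- Extending an isomorphism from a vertex-deleted subgraph to the whole graph. -/
theorem exists_iso_of_delVert_iso (G : SimpleGraph V) (v : V) {m : ℕ} {H : SimpleGraph (Fin m)}
    (K : SimpleGraph (Fin (m + 1))) (e : delVert G v ≃g H) (k : Fin (m + 1))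
    (σ : Fin m → Fin (m + 1)) (hinj : Function.Injective σ) (hk : ∀ i, σ i ≠ k)
    (hadj : ∀ i j, K.Adj (σ i) (σ j) ↔ H.Adj i j)
    (hnew : ∀ y : {y // y ≠ v}, K.Adj k (σ (e y)) ↔ G.Adj v y.1) :
    ∃ f : G ≃g K, f v = k := by
  let g : V → Fin (m + 1) := fun x => if h : x = v then k else σ (e ⟨x, h⟩)
  have hgv : g v = k := dif_pos rfl
  have hgy : ∀ y : {y // y ≠ v}, g y.1 = σ (e y) := fun y => dif_neg y.2
  have hcard : Fintype.card V = m + 1 := by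
    rw [← card_ne_add_one v, Fintype.card_congr e.toEquiv, Fintype.card_fin]
  have hg : Function.Injective g := by
    intro x y hxy
    by_cases hx : x = v <;> by_cases hy : y = v
    · rw [hx, hy]
    · rw [hx, hgv, hgy ⟨y, hy⟩] at hxy
      exact absurd hxy.symm (hk _)
    · rw [hy, hgv, hgy ⟨x, hx⟩] at hxy
      exact absurd hxy (hk _)
    · rw [hgy ⟨x, hx⟩, hgy ⟨y, hy⟩] at hxy
      exact congrArg Subtype.val (e.injective (hinj hxy))
  have hb : Function.Bijective g := by
    rw [Fintype.bijective_iff_injective_and_card]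
    exact ⟨hg, by rw [hcard, Fintype.card_fin]⟩
  refine ⟨⟨Equiv.ofBijective g hb, ?_⟩, hgv⟩
  intro x y
  change K.Adj (g x) (g y) ↔ G.Adj x y
  by_cases hx : x = v <;> by_cases hy : y = v
  · rw [hx, hy]; simp
  · rw [hx, hgv, hgy ⟨y, hy⟩, hnew]
  · rw [hy, hgv, hgy ⟨x, hx⟩, K.adj_comm, hnew, G.adj_comm]
  · rw [hgy ⟨x, hx⟩, hgy ⟨y, hy⟩, hadj, e.map_adj_iff, delVert_adj]

theorem exists_iso_of_pendant (G : SimpleGraph V) (v : V) {m : ℕ} {H : SimpleGraph (Fin m)}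
    (K : SimpleGraph (Fin (m + 1))) (e : delVert G v ≃g H) (w : {y // y ≠ v})
    (hw : ∀ y, G.Adj v y ↔ y = w.1) (k : Fin (m + 1))
    (σ : Fin m → Fin (m + 1)) (hinj : Function.Injective σ) (hk : ∀ i, σ i ≠ k)
    (hadj : ∀ i j, K.Adj (σ i) (σ j) ↔ H.Adj i j)
    (hnew : ∀ i, K.Adj k (σ i) ↔ i = e w) :
    ∃ f : G ≃g K, f v = k := by
  refine exists_iso_of_delVert_iso G v K e k σ hinj hk hadj fun y => ?_
  rw [hnew, hw, e.injective.eq_iff, Subtype.ext_iff]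

/-- Prepending a pendant vertex to a graph on `0, …, m - 1` whose end-vertex is `0`. -/
theorem exists_iso_of_pendant_zero (G : SimpleGraph V) (v : V) {m : ℕ} {H : SimpleGraph (Fin m)}
    (K : SimpleGraph (Fin (m + 1))) (e : delVert G v ≃g H) (w : {y // y ≠ v})
    (hw : ∀ y, G.Adj v y ↔ y = w.1) (he : (e w).val = 0)
    (hadj : ∀ i j : Fin m, K.Adj i.succ j.succ ↔ H.Adj i j)
    (hnew : ∀ i : Fin m, K.Adj 0 i.succ ↔ i.val = 0) :
    ∃ f : G ≃g K, (f v).val = 0 := by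
  obtain ⟨f, hf⟩ := exists_iso_of_pendant G v K e w hw 0 Fin.succ (Fin.succ_injective m)
    (fun i => Fin.succ_ne_zero i) hadj (fun i => by rw [hnew, Fin.ext_iff, he])
  exact ⟨f, by rw [hf]; rfl⟩

theorem Bgraph_succ_adj (m s : ℕ) (hm : s + 4 ≤ m) (i j : Fin m) :
    (Bgraph (m + 1) s).Adj i.succ j.succ ↔ (Bgraph m s).Adj i j := by
  simp only [Bgraph, fromRel_adj, ne_eq, Fin.succ_inj, Fin.val_succ]
  obtain ⟨k, rfl⟩ : ∃ k, m = k + s + 4 := ⟨m - s - 4, by omega⟩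
  refine and_congr Iff.rfl (or_congr ?_ ?_) <;> omega

theorem Bgraph_zero_adj (m s : ℕ) (hm : s + 4 ≤ m) (i : Fin m) :
    (Bgraph (m + 1) s).Adj 0 i.succ ↔ i.val = 0 := by
  simp only [Bgraph, fromRel_adj, ne_eq, Fin.ext_iff, Fin.val_succ, Fin.val_zero]
  omega

theorem Bn1_succ_adj (m : ℕ) (hm : 4 ≤ m) (i j : Fin m) :
    (Bn1 (m + 1)).Adj i.succ j.succ ↔ (Bn1 m).Adj i j := by
  simp only [Bn1, fromRel_adj, ne_eq, Fin.succ_inj, Fin.val_succ]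
  obtain ⟨k, rfl⟩ : ∃ k, m = k + 4 := ⟨m - 4, by omega⟩
  refine and_congr Iff.rfl (or_congr ?_ ?_) <;>
    refine or_congr ?_ (or_congr ?_ (or_congr ?_ (or_congr ?_ ?_))) <;> omega

theorem Bn1_zero_adj (m : ℕ) (hm : 4 ≤ m) (i : Fin m) :
    (Bn1 (m + 1)).Adj 0 i.succ ↔ i.val = 0 := by
  simp only [Bn1, fromRel_adj, ne_eq, Fin.ext_iff, Fin.val_succ, Fin.val_zero]
  omega

/-- A triangle with a path attached, the vertices being numbered from the far end of the path. -/
def kite (n : ℕ) : SimpleGraph (Fin n) :=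
  SimpleGraph.fromRel (fun a b => a.val + 1 = b.val ∨ (a.val = n - 3 ∧ b.val = n - 1))

theorem kite_succ_adj (m : ℕ) (hm : 3 ≤ m) (i j : Fin m) :
    (kite (m + 1)).Adj i.succ j.succ ↔ (kite m).Adj i j := by
  simp only [kite, fromRel_adj, ne_eq, Fin.succ_inj, Fin.val_succ]
  refine and_congr Iff.rfl (or_congr ?_ ?_) <;> omega

theorem kite_zero_adj (m : ℕ) (hm : 3 ≤ m) (i : Fin m) :
    (kite (m + 1)).Adj 0 i.succ ↔ i.val = 0 := by
  simp only [kite, fromRel_adj, ne_eq, Fin.ext_iff, Fin.val_succ, Fin.val_zero]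
  omega

theorem B33_succ_adj (m : ℕ) (hm : 4 ≤ m) (i j : Fin m) :
    (B33 (m + 1)).Adj i.succ j.succ ↔ (kite m).Adj i j := by
  simp only [B33, kite, fromRel_adj, ne_eq, Fin.succ_inj, Fin.val_succ]
  refine and_congr Iff.rfl (or_congr ?_ ?_) <;> omega

theorem B33_zero_adj (m : ℕ) (hm : 4 ≤ m) (i : Fin m) :
    (B33 (m + 1)).Adj 0 i.succ ↔ i.val = 0 ∨ i.val = 1 := by
  simp only [B33, fromRel_adj, ne_eq, Fin.ext_iff, Fin.val_succ, Fin.val_zero, true_and]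
  omega

/-- An isomorphism from an enumeration of the vertices. -/
theorem exists_iso_of_enumeration (G : SimpleGraph V) {m : ℕ} (K : SimpleGraph (Fin m))
    (f : Fin m → V) (hcard : Fintype.card V = m) (hf : Function.Injective f)
    (hadj : ∀ i j, i < j → (K.Adj i j ↔ G.Adj (f i) (f j))) :
    ∃ e : G ≃g K, ∀ i, e (f i) = i := by
  have hb : Function.Bijective f := by
    rw [Fintype.bijective_iff_injective_and_card]
    exact ⟨hf, by rw [hcard, Fintype.card_fin]⟩
  have hadj' : ∀ i j, G.Adj (f i) (f j) ↔ K.Adj i j := by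
    intro i j
    rcases lt_trichotomy i j with h | h | h
    · rw [hadj i j h]
    · rw [h]; simp
    · rw [G.adj_comm, K.adj_comm, hadj j i h]
  let e : K ≃g G := ⟨Equiv.ofBijective f hb, fun {i j} => hadj' i j⟩
  exact ⟨e.symm, fun i => e.symm_apply_apply i⟩

theorem sum_valency_of_enumeration (G : SimpleGraph V) {m : ℕ} (f : Fin m → V)
    (hcard : Fintype.card V = m) (hf : Function.Injective f) :
    ∑ v, valency G v = ∑ i, ∑ j, adjInd G (f i) (f j) := by
  have hb : Function.Bijective f := by
    rw [Fintype.bijective_iff_injective_and_card]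
    exact ⟨hf, by rw [hcard, Fintype.card_fin]⟩
  simp_rw [valency_eq_sum]
  rw [← hb.sum_comp]
  exact Finset.sum_congr rfl fun i _ => (hb.sum_comp _).symm

end Attach

section Rooted

universe u

theorem exists_iso_of_card_four {V : Type*} [Fintype V] (H : SimpleGraph V) (w : V)
    (hcard : Fintype.card V = 4) (hs : ∑ v, valency H v = 10) :
    (∃ e : H ≃g Bgraph 4 0, (e w).val = 0) ∨ ∃ e : H ≃g Bn1 4, (e w).val = 0 := by
  have h3 : (univ.erase w).card = 3 := by
    rw [Finset.card_erase_of_mem (Finset.mem_univ _), Finset.card_univ, hcard]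
  obtain ⟨a, b, c, hab, hac, hbc, hset⟩ := Finset.card_eq_three.1 h3
  have hne : ∀ y, y ≠ w ↔ y = a ∨ y = b ∨ y = c := fun y => by
    simpa using Finset.ext_iff.1 hset y
  have hwa : w ≠ a := ((hne a).2 (by simp)).symm
  have hwb : w ≠ b := ((hne b).2 (by simp)).symm
  have hwc : w ≠ c := ((hne c).2 (by simp)).symm
  have hinj : ∀ p q r : V, w ≠ p → w ≠ q → w ≠ r → p ≠ q → p ≠ r → q ≠ r →
      Function.Injective ![w, p, q, r] := by
    intro p q r h1 h2 h3 h4 h5 h6 i j h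
    fin_cases i <;> fin_cases j <;> simp_all
  have hB : ∀ p q r : V, w ≠ p → w ≠ q → w ≠ r → p ≠ q → p ≠ r → q ≠ r → ¬ H.Adj w q →
      H.Adj w p → H.Adj w r → H.Adj p q → H.Adj p r → H.Adj q r →
      ∃ e : H ≃g Bgraph 4 0, (e w).val = 0 := by
    intro p q r h1 h2 h3 h4 h5 h6 k1 k2 k3 k4 k5 k6
    obtain ⟨e, he⟩ := exists_iso_of_enumeration H (Bgraph 4 0) ![w, p, q, r] hcard
      (hinj p q r h1 h2 h3 h4 h5 h6) (by
        intro i j h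
        fin_cases i <;> fin_cases j <;>
          first
          | exact absurd h (by decide)
          | simp [Bgraph, k1, k2, k3, k4, k5, k6])
    exact ⟨e, by have := he 0; simp at this; rw [this]; rfl⟩
  have hC : ∀ p q r : V, w ≠ p → w ≠ q → w ≠ r → p ≠ q → p ≠ r → q ≠ r → H.Adj w q →
      H.Adj w p → H.Adj w r → H.Adj p q → H.Adj p r → ¬ H.Adj q r →
      ∃ e : H ≃g Bn1 4, (e w).val = 0 := by
    intro p q r h1 h2 h3 h4 h5 h6 k1 k2 k3 k4 k5 k6
    obtain ⟨e, he⟩ := exists_iso_of_enumeration H (Bn1 4) ![w, p, q, r] hcard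
      (hinj p q r h1 h2 h3 h4 h5 h6) (by
        intro i j h
        fin_cases i <;> fin_cases j <;>
          first
          | exact absurd h (by decide)
          | simp [Bn1, k1, k2, k3, k4, k5, k6])
    exact ⟨e, by have := he 0; simp at this; rw [this]; rfl⟩
  rw [sum_valency_of_enumeration H ![w, a, b, c] hcard (hinj a b c hwa hwb hwc hab hac hbc)] at hs
  simp only [Fin.sum_univ_four, Matrix.cons_val_zero, Matrix.cons_val_one, Matrix.cons_val,
    adjInd_self, adjInd_comm H a w, adjInd_comm H b w, adjInd_comm H c w,
    adjInd_comm H b a, adjInd_comm H c a, adjInd_comm H c b] at hs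
  have i1 := adjInd_le_one H w a
  have i2 := adjInd_le_one H w b
  have i3 := adjInd_le_one H w c
  have i4 := adjInd_le_one H a b
  have i5 := adjInd_le_one H a c
  have i6 := adjInd_le_one H b c
  by_cases k1 : H.Adj w a
  · by_cases k2 : H.Adj w b
    · by_cases k3 : H.Adj w c
      · by_cases k4 : H.Adj a b
        · by_cases k5 : H.Adj a c
          · by_cases k6 : H.Adj b c
            · have j1 := adjInd_eq_one H k1
              have j2 := adjInd_eq_one H k2
              have j3 := adjInd_eq_one H k3
              have j4 := adjInd_eq_one H k4
              have j5 := adjInd_eq_one H k5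
              have j6 := adjInd_eq_one H k6
              omega
            · exact Or.inr (hC a b c hwa hwb hwc hab hac hbc k2 k1 k3 k4 k5 k6)
          · have j5 := adjInd_eq_zero H k5
            have k6 : H.Adj b c := by by_contra k6; have := adjInd_eq_zero H k6; omega
            exact Or.inr (hC b a c hwb hwa hwc hab.symm hbc hac k1 k2 k3 k4.symm k6 k5)
        · have j4 := adjInd_eq_zero H k4
          have k6 : H.Adj b c := by
            by_contra k6; have := adjInd_eq_zero H k6; omega
          have k5 : H.Adj a c := by by_contra k5; have := adjInd_eq_zero H k5; omega
          exact Or.inr (hC c a b hwc hwa hwb hac.symm hbc.symm hab k1 k3 k2 k5.symm k6.symm k4)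
      · have j3 := adjInd_eq_zero H k3
        have k4 : H.Adj a b := by by_contra k4; have := adjInd_eq_zero H k4; omega
        have k5 : H.Adj a c := by by_contra k5; have := adjInd_eq_zero H k5; omega
        have k6 : H.Adj b c := by by_contra k6; have := adjInd_eq_zero H k6; omega
        exact Or.inl (hB a c b hwa hwc hwb hac hab hbc.symm k3 k1 k2 k5 k4 k6.symm)
    · have j2 := adjInd_eq_zero H k2
      have k3 : H.Adj w c := by by_contra k3; have := adjInd_eq_zero H k3; omega
      have k4 : H.Adj a b := by by_contra k4; have := adjInd_eq_zero H k4; omega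
      have k5 : H.Adj a c := by by_contra k5; have := adjInd_eq_zero H k5; omega
      have k6 : H.Adj b c := by by_contra k6; have := adjInd_eq_zero H k6; omega
      exact Or.inl (hB a b c hwa hwb hwc hab hac hbc k2 k1 k3 k4 k5 k6)
  · have j1 := adjInd_eq_zero H k1
    have k2 : H.Adj w b := by by_contra k2; have := adjInd_eq_zero H k2; omega
    have k3 : H.Adj w c := by by_contra k3; have := adjInd_eq_zero H k3; omega
    have k4 : H.Adj a b := by by_contra k4; have := adjInd_eq_zero H k4; omega
    have k5 : H.Adj a c := by by_contra k5; have := adjInd_eq_zero H k5; omega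
    have k6 : H.Adj b c := by by_contra k6; have := adjInd_eq_zero H k6; omega
    exact Or.inl (hB b a c hwb hwa hwc hab.symm hbc hac k1 k2 k3 k4.symm k6 k5)

theorem exists_iso_of_card_five {V : Type*} [Fintype V] (H : SimpleGraph V) (w : V)
    (hH : H.Connected) (hcard : Fintype.card V = 5) (hs : ∑ v, valency H v = 12)
    (hw : 2 ≤ valency H w) (hD : 7 ≤ distSum H w) :
    ∃ e : H ≃g Bgraph 5 1, (e w).val = 0 := by
  have f0 := farCount_zero H hH w
  have f1 := farCount_one H hH w
  have e0 := excessSum_succ H w 0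
  have e1 := excessSum_succ H w 1
  have e2 := excessSum_succ H w 2
  have d1 : farCount H w 1 = farCount H w 2 + (univ.filter fun y => H.dist w y = 2).card :=
    farCount_succ H w 1
  have d2 := farCount_succ_lt H hH w 1
  have d3 := farCount_succ_lt H hH w 2
  have z2 := excessSum_eq_zero H w 2
  have z3 := excessSum_eq_zero H w 3
  rw [distSum_eq_excessSum] at hD
  simp only [Nat.reduceAdd, zero_add] at *
  have g2 : farCount H w 2 = 1 := by omega
  have g1 : farCount H w 1 = 2 := by omega
  have g3 : valency H w = 2 := by omega
  obtain ⟨a, b, hab, hN⟩ := exists_two_neighbors H w g3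
  obtain ⟨c, hc⟩ := Finset.card_eq_one.1
    (by omega : (univ.filter fun y => H.dist w y = 2).card = 1)
  obtain ⟨d, hd⟩ := Finset.card_eq_one.1 g2
  have hc' : H.dist w c = 2 := by
    have := Finset.mem_singleton_self c
    rw [← hc] at this
    simpa using this
  have hd' : 2 < H.dist w d := by
    have := Finset.mem_singleton_self d
    rw [← hd] at this
    simpa using this
  have ha' : H.dist w a = 1 := SimpleGraph.dist_eq_one_iff_adj.2 ((hN a).2 (Or.inl rfl))
  have hb' : H.dist w b = 1 := SimpleGraph.dist_eq_one_iff_adj.2 ((hN b).2 (Or.inr rfl))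
  have hw' : H.dist w w = 0 := SimpleGraph.dist_self
  have hne : ∀ x y, H.dist w x ≠ H.dist w y → x ≠ y := fun x y h hxy => h (by rw [hxy])
  have hnadj : ∀ x y, H.dist w x + 1 < H.dist w y → ¬ H.Adj x y := by
    intro x y h hxy
    have h1 := hH.dist_triangle (u := w) (v := x) (w := y)
    rw [SimpleGraph.dist_eq_one_iff_adj.2 hxy] at h1
    omega
  have hwa := hne w a (by omega)
  have hwb := hne w b (by omega)
  have hwc := hne w c (by omega)
  have hwd := hne w d (by omega)
  have hac := hne a c (by omega)
  have had := hne a d (by omega)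
  have hbc := hne b c (by omega)
  have hbd := hne b d (by omega)
  have hcd := hne c d (by omega)
  have hinj : Function.Injective ![w, a, c, d, b] := by
    intro i j h
    fin_cases i <;> fin_cases j <;> simp_all
  have n1 := hnadj w c (by omega)
  have n2 := hnadj w d (by omega)
  have n3 := hnadj a d (by omega)
  have n4 := hnadj b d (by omega)
  have p1 : H.Adj w a := (hN a).2 (Or.inl rfl)
  have p2 : H.Adj w b := (hN b).2 (Or.inr rfl)
  rw [sum_valency_of_enumeration H ![w, a, c, d, b] hcard hinj] at hs
  simp only [Fin.sum_univ_five, Matrix.cons_val_zero, Matrix.cons_val_one, Matrix.cons_val,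
    adjInd_self, adjInd_comm H a w, adjInd_comm H b w, adjInd_comm H c w, adjInd_comm H d w,
    adjInd_comm H b a, adjInd_comm H c a, adjInd_comm H d a, adjInd_comm H d b, adjInd_comm H d c,
    adjInd_comm H c b, adjInd_eq_zero H n1, adjInd_eq_zero H n2, adjInd_eq_zero H n3,
    adjInd_eq_zero H n4, adjInd_eq_one H p1, adjInd_eq_one H p2] at hs
  have i4 := adjInd_le_one H a b
  have i5 := adjInd_le_one H a c
  have i6 := adjInd_le_one H b c
  have i7 := adjInd_le_one H c d
  have k4 : H.Adj a b := by by_contra k4; have := adjInd_eq_zero H k4; omega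
  have k5 : H.Adj a c := by by_contra k5; have := adjInd_eq_zero H k5; omega
  have k6 : H.Adj b c := by by_contra k6; have := adjInd_eq_zero H k6; omega
  have k7 : H.Adj c d := by by_contra k7; have := adjInd_eq_zero H k7; omega
  clear hs hd hc d1 hN hnadj hne
  have k8 := k6.symm
  have n5 : ¬ H.Adj d b := fun h => n4 h.symm
  obtain ⟨e, he⟩ := exists_iso_of_enumeration H (Bgraph 5 1) ![w, a, c, d, b] hcard hinj (by
        intro i j h
        fin_cases i <;> fin_cases j <;>
          first
          | exact absurd h (by decide)
          | simp [Bgraph, k4, k5, k7, k8, n1, n2, n3, n5, p1, p2])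
  exact ⟨e, by have := he 0; simp at this; rw [this]; rfl⟩

/-- A rooted bicyclic graph with large sum of distances from the root. -/
theorem exists_rooted_iso (m : ℕ) : ∀ (V : Type u) [Fintype V] (H : SimpleGraph V) (w : V),
    H.Connected → Fintype.card V = m → ∑ v, valency H v = 2 * m + 2 → 4 ≤ m →
    (m : ℤ) ^ 2 - m - 6 ≤ 2 * distSum H w →
    (∃ e : H ≃g Bgraph m 0, (e w).val = 0) ∨
    (5 ≤ m ∧ ∃ e : H ≃g Bgraph m 1, (e w).val = 0) ∨
    ∃ e : H ≃g Bn1 m, (e w).val = 0 := by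
  induction m with
  | zero => intro V _ H w _ _ _ h; omega
  | succ m ih =>
    intro V _ H w hH hcard hs hm hD
    rcases (by omega : m = 3 ∨ 4 ≤ m) with rfl | hm4
    · rcases exists_iso_of_card_four H w hcard hs with h | h
      · exact Or.inl h
      · exact Or.inr (Or.inr h)
    rcases Nat.lt_or_ge (valency H w) 2 with hv | hv
    · have hv1 : valency H w = 1 := by
        have := valency_pos H hH (by omega) w
        omega
      obtain ⟨z, hz⟩ := exists_unique_neighbor H w hv1
      have hc := delVert_connected_of_valency_one H hH w hv1
      have h1 := card_ne_add_one w
      have h2 := sum_valency_delVert H w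
      have h3 := distSum_le_delVert H hH w z ((hz _).2 rfl) hc
      rw [hcard] at h3
      push_cast at h3 hD
      rcases ih _ (delVert H w) z hc (by omega) (by omega) hm4 (by linarith) with
        ⟨e, he⟩ | ⟨h5, e, he⟩ | ⟨e, he⟩
      · exact Or.inl (exists_iso_of_pendant_zero H w _ e z hz he (Bgraph_succ_adj m 0 hm4)
          (Bgraph_zero_adj m 0 hm4))
      · exact Or.inr (Or.inl ⟨by omega, exists_iso_of_pendant_zero H w _ e z hz he
          (Bgraph_succ_adj m 1 h5) (Bgraph_zero_adj m 1 h5)⟩)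
      · exact Or.inr (Or.inr (exists_iso_of_pendant_zero H w _ e z hz he (Bn1_succ_adj m hm4)
          (Bn1_zero_adj m hm4)))
    · have h1 := distSum_le_of_two_le_valency H hH w hv
      rw [hcard] at h1
      push_cast at h1 hD
      have h2 : m = 4 := by
        have : (m : ℤ) < 5 := by nlinarith
        omega
      subst h2
      exact Or.inr (Or.inl ⟨by omega, exists_iso_of_card_five H w hH hcard hs hv
        (by norm_num at hD; linarith)⟩)

theorem mem_of_adj_closed {V : Type*} (G : SimpleGraph V) (hG : G.Connected) (S : Set V)
    (x : V) (hx : x ∈ S) (hS : ∀ u ∈ S, ∀ v, G.Adj u v → v ∈ S) (y : V) : y ∈ S := by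
  obtain ⟨p⟩ := hG.preconnected x y
  induction p with
  | nil => exact hx
  | cons h q ih => exact ih (hS _ hx _ h)

theorem exists_iso_kite_three {V : Type*} [Fintype V] (U : SimpleGraph V)
    (hcard : Fintype.card V = 3) (p q r : V) (h1 : U.Adj p q) (h2 : U.Adj p r) (h3 : U.Adj q r) :
    ∃ e : U ≃g kite 3, (e p).val = 0 := by
  obtain ⟨e, he⟩ := exists_iso_of_enumeration U (kite 3) ![p, q, r] hcard
    (by
      have h4 := h1.ne
      have h5 := h2.ne
      have h6 := h3.ne
      clear h1 h2 h3
      intro i j h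
      fin_cases i <;> fin_cases j <;> simp_all)
    (by
      intro i j h
      fin_cases i <;> fin_cases j <;>
        first
        | exact absurd h (by decide)
        | simp [kite, h1, h2, h3])
  exact ⟨e, by have := he 0; simp at this; rw [this]; rfl⟩

/-- A unicyclic graph with at most one pendant vertex and an almost free triangle is a triangle
with an attached path. -/
theorem exists_iso_kite (m : ℕ) : ∀ (V : Type u) [Fintype V] (U : SimpleGraph V) (w x b a : V),
    U.Connected → Fintype.card V = m → ∑ v, valency U v = 2 * m →
    (∀ v, v ≠ w → 2 ≤ valency U v) → U.Adj x b → U.Adj x a → U.Adj b a →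
    valency U x = 2 → valency U b = 2 → ∃ e : U ≃g kite m, (e w).val = 0 := by
  induction m with
  | zero =>
    intro V _ U w _ _ _ _ h
    have := Fintype.card_pos_iff.2 ⟨w⟩
    omega
  | succ m ih =>
    intro V _ U w x b a hU hcard hs hdeg hxb hxa hba hvx hvb
    have hm := three_le_card_of_unicyclic U hU (by omega)
    have hNx : ∀ y, U.Adj x y → y = b ∨ y = a := by
      obtain ⟨p, q, hpq, h⟩ := exists_two_neighbors U x hvx
      intro y hy
      have h1 := (h b).1 hxb
      have h2 := (h a).1 hxa
      have h3 := (h y).1 hy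
      have h4 := hba.ne
      grind
    have hNb : ∀ y, U.Adj b y → y = x ∨ y = a := by
      obtain ⟨p, q, hpq, h⟩ := exists_two_neighbors U b hvb
      intro y hy
      have h1 := (h x).1 hxb.symm
      have h2 := (h a).1 hba
      have h3 := (h y).1 hy
      have h4 := hxa.ne
      grind
    rcases Nat.lt_or_ge (valency U w) 2 with hv | hv
    · have hv1 : valency U w = 1 := by
        have := valency_pos U hU (by omega) w
        omega
      obtain ⟨z, hz⟩ := exists_unique_neighbor U w hv1
      have hc := delVert_connected_of_valency_one U hU w hv1
      have h1 := card_ne_add_one w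
      have h2 := sum_valency_delVert U w
      have h3 := three_le_card_of_unicyclic (delVert U w) hc (by omega)
      have hxw : x ≠ w := by rintro rfl; omega
      have hbw : b ≠ w := by rintro rfl; omega
      have haw : a ≠ w := by
        rintro rfl
        exact hxb.ne (((hz _).1 hxa.symm).trans ((hz _).1 hba.symm).symm)
      have hwx : ¬ U.Adj w x := fun h => by
        rcases hNx w h.symm with h | h
        · exact hbw h.symm
        · exact haw h.symm
      have hwb : ¬ U.Adj w b := fun h => by
        rcases hNb w h.symm with h | h
        · exact hxw h.symm
        · exact haw h.symm
      obtain ⟨e, he⟩ := ih _ (delVert U w) z ⟨x, hxw⟩ ⟨b, hbw⟩ ⟨a, haw⟩ hc (by omega) (by omega)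
        (by
          intro v hvz
          have h4 := valency_delVert U w v
          have h5 := hdeg v.1 v.2
          have h6 : ¬ U.Adj w v.1 := fun h => hvz (Subtype.ext ((hz _).1 h))
          rw [if_neg h6] at h4
          omega)
        hxb hxa hba
        (by
          have h4 := valency_delVert U w ⟨x, hxw⟩
          rw [if_neg hwx] at h4
          exact h4.symm.trans hvx)
        (by
          have h4 := valency_delVert U w ⟨b, hbw⟩
          rw [if_neg hwb] at h4
          exact h4.symm.trans hvb)
      exact exists_iso_of_pendant_zero U w _ e z hz he (kite_succ_adj m (by omega))
        (kite_zero_adj m (by omega))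
    · have hall : ∀ v, 2 ≤ valency U v := fun v => by
        by_cases h : v = w
        · rw [h]; exact hv
        · exact hdeg v h
      have hva : valency U a = 2 := by
        by_contra hne
        have h1 : ∑ v : V, 2 < ∑ v, valency U v :=
          Finset.sum_lt_sum (fun v _ => hall v)
            ⟨a, Finset.mem_univ a, lt_of_le_of_ne (hall a) (Ne.symm hne)⟩
        simp only [Finset.sum_const, Finset.card_univ, hcard, smul_eq_mul] at h1
        omega
      have hNa : ∀ y, U.Adj a y → y = x ∨ y = b := by
        obtain ⟨p, q, hpq, h⟩ := exists_two_neighbors U a hva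
        intro y hy
        have h1 := (h x).1 hxa.symm
        have h2 := (h b).1 hba.symm
        have h3 := (h y).1 hy
        have h4 := hxb.ne
        grind
      have hmem := mem_of_adj_closed U hU {y | y = x ∨ y = b ∨ y = a} x (Or.inl rfl) (by
        intro u hu v huv
        simp only [Set.mem_ofPred_eq] at hu ⊢
        rcases hu with rfl | rfl | rfl
        · have := hNx v huv; tauto
        · have := hNb v huv; tauto
        · have := hNa v huv; tauto)
      have hle : Fintype.card V ≤ 3 := by
        rw [← Finset.card_univ]
        refine (Finset.card_le_card (t := {x, b, a}) fun y _ => ?_).trans Finset.card_le_three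
        simpa using hmem y
      have hm2 : m = 2 := by omega
      subst hm2
      rcases hmem w with rfl | rfl | rfl
      · exact exists_iso_kite_three U hcard _ _ _ hxb hxa hba
      · exact exists_iso_kite_three U hcard _ _ _ hxb.symm hba hxa
      · exact exists_iso_kite_three U hcard _ _ _ hxa.symm hba.symm hxb

end Rooted

section NoPendant

variable {V : Type*}

theorem dist_eq_two (G : SimpleGraph V) (hG : G.Connected) {x u y : V} (hxu : G.Adj x u)
    (huy : G.Adj u y) (hne : x ≠ y) (hn : ¬ G.Adj x y) : G.dist x y = 2 := by
  have h1 := hG.dist_triangle (u := x) (v := u) (w := y)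
  rw [SimpleGraph.dist_eq_one_iff_adj.2 hxu, SimpleGraph.dist_eq_one_iff_adj.2 huy] at h1
  have h2 := mt SimpleGraph.dist_eq_one_iff_adj.1 hn
  have h3 := hG.pos_dist_of_ne hne
  omega

variable [Fintype V]

theorem card_le_of_adj_closed (G : SimpleGraph V) (hG : G.Connected) (S : Finset V) (x : V)
    (hx : x ∈ S) (hS : ∀ u ∈ S, ∀ v, G.Adj u v → v ∈ S) : Fintype.card V ≤ S.card := by
  rw [← Finset.card_univ]
  exact Finset.card_le_card fun y _ => mem_of_adj_closed G hG (S : Set V) x hx hS y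

theorem adj_of_card_le_valency (G : SimpleGraph V) (v : V) (S : Finset V)
    (hsub : ∀ y, G.Adj v y → y ∈ S) (h : S.card ≤ valency G v) : ∀ y ∈ S, G.Adj v y := by
  intro y hy
  rw [← Finset.eq_of_subset_of_card_le
    (s := univ.filter fun y => G.Adj v y) (fun z hz => hsub z (by simpa using hz)) h] at hy
  simpa using hy

theorem valency_eq_card (G : SimpleGraph V) (v : V) (S : Finset V)
    (h : ∀ y, G.Adj v y ↔ y ∈ S) : valency G v = S.card := by
  rw [valency]
  congr 1
  ext y
  simp [h]

theorem mem_of_valency_le_card (G : SimpleGraph V) (v : V) (S : Finset V)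
    (hsub : ∀ y ∈ S, G.Adj v y) (h : valency G v ≤ S.card) : ∀ y, G.Adj v y → y ∈ S := by
  intro y hy
  rw [Finset.eq_of_subset_of_card_le
    (t := univ.filter fun y => G.Adj v y) (fun z hz => by simpa using hsub z hz) h]
  simpa using hy

theorem two_le_valency_of_adj (G : SimpleGraph V) (hcard : 3 ≤ Fintype.card V) (y : V)
    (hc : (delVert G y).Connected) (b : V) (hb : G.Adj y b) : 2 ≤ valency G b := by
  have h1 := valency_delVert G y ⟨b, hb.ne'⟩
  rw [if_pos hb] at h1
  have h2 := valency_pos _ hc (by have := card_ne_add_one y; omega) ⟨b, hb.ne'⟩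
  simp only at h1
  omega

theorem card_valency_ne_two_le (G : SimpleGraph V) (hdeg : ∀ v, 2 ≤ valency G v)
    (hs : ∑ v, valency G v = 2 * Fintype.card V + 2) :
    (univ.filter fun v => valency G v ≠ 2).card ≤ 2 := by
  have h1 : ∑ v : V, (2 + if valency G v ≠ 2 then 1 else 0) ≤ ∑ v, valency G v := by
    refine Finset.sum_le_sum fun v _ => ?_
    have := hdeg v
    split_ifs <;> omega
  rw [Finset.sum_add_distrib, ← Finset.card_filter, Finset.sum_const, Finset.card_univ,
    smul_eq_mul] at h1
  omega

/-- In a bicyclic graph without pendant vertices where no non-cut vertex of degree two has two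
vertices at distance two, every such vertex lies in a triangle hanging at a vertex of degree
three. -/
theorem exists_triangle (G : SimpleGraph V) (hG : G.Connected) (hdeg : ∀ v, 2 ≤ valency G v)
    (hs : ∑ v, valency G v = 2 * Fintype.card V + 2) (hcard : 5 ≤ Fintype.card V)
    (hsmall : ∀ x, valency G x = 2 → (delVert G x).Connected →
      (univ.filter fun y => G.dist x y = 2).card ≤ 1)
    (x : V) (hx : valency G x = 2) (hc : (delVert G x).Connected) :
    ∃ a b, G.Adj x a ∧ G.Adj x b ∧ G.Adj a b ∧ valency G b = 2 ∧ valency G a = 3 := by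
  have layer : ∀ x, valency G x = 2 → (delVert G x).Connected → ∀ y z, G.dist x y = 2 →
      G.dist x z = 2 → y = z := by
    intro x h1 h2 y z hy hz
    exact Finset.card_le_one.1 (hsmall x h1 h2) y (by simpa using hy) z (by simpa using hz)
  obtain ⟨a, b, hab, hN⟩ := exists_two_neighbors G x hx
  have hxa : G.Adj x a := (hN a).2 (Or.inl rfl)
  have hxb : G.Adj x b := (hN b).2 (Or.inr rfl)
  have hlayer : ∀ u y, G.Adj x u → G.Adj u y → y ≠ x → y ≠ a → y ≠ b → G.dist x y = 2 := by
    intro u y h1 h2 h3 h4 h5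
    exact dist_eq_two G hG h1 h2 h3.symm fun h => by
      rcases (hN y).1 h with h | h
      · exact h4 h
      · exact h5 h
  obtain ⟨c, hcx, hca, hcb, hcc⟩ :
      ∃ c, c ≠ x ∧ c ≠ a ∧ c ≠ b ∧ (G.Adj a c ∨ G.Adj b c) := by
    by_contra hno
    have h1 := card_le_of_adj_closed G hG {x, a, b} x (by simp) (by
      intro u hu v huv
      simp only [Finset.mem_insert, Finset.mem_singleton] at hu ⊢
      by_contra hv
      push Not at hv hno
      obtain ⟨h3, h4, h5⟩ := hv
      have h6 := hno v h3 h4 h5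
      rcases hu with rfl | rfl | rfl
      · rcases (hN v).1 huv with h | h
        · exact h4 h
        · exact h5 h
      · exact h6.1 huv
      · exact h6.2 huv)
    have h2 : ({x, a, b} : Finset V).card ≤ 3 := Finset.card_le_three
    omega
  have hc2 : G.dist x c = 2 := by
    rcases hcc with h | h
    · exact hlayer a c hxa h hcx hca hcb
    · exact hlayer b c hxb h hcx hca hcb
  have huniq : ∀ u y, G.Adj x u → G.Adj u y → y = x ∨ y = a ∨ y = b ∨ y = c := by
    intro u y h1 h2
    by_contra h
    push Not at h
    exact h.2.2.2 (layer x hx hc y c (hlayer u y h1 h2 h.1 h.2.1 h.2.2.1) hc2)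
  have hclosed : (∀ y, G.Adj c y → y = a ∨ y = b) → False := by
    intro hNc
    have h1 := card_le_of_adj_closed G hG {x, a, b, c} x (by simp) (by
      intro u hu v huv
      simp only [Finset.mem_insert, Finset.mem_singleton] at hu ⊢
      rcases hu with rfl | rfl | rfl | rfl
      · have := (hN v).1 huv; tauto
      · exact huniq _ v hxa huv
      · exact huniq _ v hxb huv
      · have := hNc v huv; tauto)
    have h2 : ({x, a, b, c} : Finset V).card ≤ 4 := Finset.card_le_four
    omega
  by_cases hadj : G.Adj a b
  · by_cases hbc : G.Adj b c
    · by_cases hac : G.Adj a c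
      · exfalso
        have hva : 3 ≤ valency G a := by
          rw [← Finset.card_eq_three.2 ⟨x, b, c, hxb.ne, hcx.symm, hcb.symm, rfl⟩]
          refine Finset.card_le_card fun y hy => ?_
          simp only [Finset.mem_insert, Finset.mem_singleton] at hy
          rcases hy with rfl | rfl | rfl
          · simpa using hxa.symm
          · simpa using hadj
          · simpa using hac
        have hvb : 3 ≤ valency G b := by
          rw [← Finset.card_eq_three.2 ⟨x, a, c, hxa.ne, hcx.symm, hca.symm, rfl⟩]
          refine Finset.card_le_card fun y hy => ?_
          simp only [Finset.mem_insert, Finset.mem_singleton] at hy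
          rcases hy with rfl | rfl | rfl
          · simpa using hxb.symm
          · simpa using hadj.symm
          · simpa using hbc
        have hvc : valency G c ≤ 2 := by
          by_contra hvc
          have h1 := card_valency_ne_two_le G hdeg hs
          have h2 : ({a, b, c} : Finset V).card ≤ (univ.filter fun v => valency G v ≠ 2).card := by
            refine Finset.card_le_card fun y hy => ?_
            simp only [Finset.mem_insert, Finset.mem_singleton] at hy
            simp only [Finset.mem_filter, Finset.mem_univ, true_and]
            rcases hy with rfl | rfl | rfl <;> omega
          rw [Finset.card_eq_three.2 ⟨a, b, c, hab, hca.symm, hcb.symm, rfl⟩] at h2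
          omega
        refine hclosed fun y hy => ?_
        have := mem_of_valency_le_card G c {a, b} (by
          intro z hz
          simp only [Finset.mem_insert, Finset.mem_singleton] at hz
          rcases hz with rfl | rfl
          · exact hac.symm
          · exact hbc.symm) (by rw [Finset.card_pair hab]; exact hvc) y hy
        simpa using this
      · refine ⟨b, a, hxb, hxa, hadj.symm, ?_, ?_⟩
        · refine valency_eq_two G a x b hxb.ne fun y => ⟨fun h => ?_, ?_⟩
          · rcases huniq a y hxa h with k | k | k | k
            · exact Or.inl k
            · exact absurd k h.ne'
            · exact Or.inr k
            · exact absurd (k ▸ h) hac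
          · rintro (rfl | rfl)
            · exact hxa.symm
            · exact hadj
        · rw [valency_eq_card G b {x, a, c} fun y => ?_]
          · exact Finset.card_eq_three.2 ⟨x, a, c, hxa.ne, hcx.symm, hca.symm, rfl⟩
          · simp only [Finset.mem_insert, Finset.mem_singleton]
            constructor
            · intro h
              have h1 := huniq b y hxb h
              have h2 := h.ne'
              tauto
            · rintro (rfl | rfl | rfl)
              · exact hxb.symm
              · exact hadj.symm
              · exact hbc
    · have hac : G.Adj a c := hcc.resolve_right hbc
      refine ⟨a, b, hxa, hxb, hadj, ?_, ?_⟩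
      · refine valency_eq_two G b x a hxa.ne fun y => ⟨fun h => ?_, ?_⟩
        · rcases huniq b y hxb h with k | k | k | k
          · exact Or.inl k
          · exact Or.inr k
          · exact absurd k h.ne'
          · exact absurd (k ▸ h) hbc
        · rintro (rfl | rfl)
          · exact hxb.symm
          · exact hadj.symm
      · rw [valency_eq_card G a {x, b, c} fun y => ?_]
        · exact Finset.card_eq_three.2 ⟨x, b, c, hxb.ne, hcx.symm, hcb.symm, rfl⟩
        · simp only [Finset.mem_insert, Finset.mem_singleton]
          constructor
          · intro h
            have h1 := huniq a y hxa h
            have h2 := h.ne'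
            tauto
          · rintro (rfl | rfl | rfl)
            · exact hxa.symm
            · exact hadj
            · exact hac
  · exfalso
    have hNa : ∀ y, G.Adj a y → y ∈ ({x, c} : Finset V) := by
      intro y h
      simp only [Finset.mem_insert, Finset.mem_singleton]
      rcases huniq a y hxa h with k | k | k | k
      · exact Or.inl k
      · exact absurd k h.ne'
      · exact absurd (k ▸ h) hadj
      · exact Or.inr k
    have hNb : ∀ y, G.Adj b y → y ∈ ({x, c} : Finset V) := by
      intro y h
      simp only [Finset.mem_insert, Finset.mem_singleton]
      rcases huniq b y hxb h with k | k | k | k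
      · exact Or.inl k
      · exact absurd (k ▸ h) (fun h => hadj h.symm)
      · exact absurd k h.ne'
      · exact Or.inr k
    have hcard2 : ({x, c} : Finset V).card = 2 := Finset.card_pair hcx.symm
    have hac := adj_of_card_le_valency G a _ hNa (by rw [hcard2]; exact hdeg a) c (by simp)
    have hbc := adj_of_card_le_valency G b _ hNb (by rw [hcard2]; exact hdeg b) c (by simp)
    have hva : valency G a = 2 := by
      rw [valency_eq_card G a {x, c} fun y => ⟨hNa y, fun h => ?_⟩, hcard2]
      exact adj_of_card_le_valency G a _ hNa (by rw [hcard2]; exact hdeg a) y h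
    have hconn : (delVert G a).Connected := by
      let φ : delVert G x →g delVert G a :=
        { toFun := fun v => if h : v.1 = a then ⟨b, hab.symm⟩ else ⟨v.1, h⟩
          map_rel' := by
            intro p q hpq
            have hpq' : G.Adj p.1 q.1 := hpq
            have hpx := p.2
            have hqx := q.2
            by_cases hp : p.1 = a
            · have h1 := hNa q.1 (hp ▸ hpq')
              simp only [Finset.mem_insert, Finset.mem_singleton, hqx, false_or] at h1
              have hq : q.1 ≠ a := by rw [h1]; exact hca
              simp only [hp, hq, dite_true, dite_false, delVert_adj]
              rw [h1]
              exact hbc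
            · by_cases hq : q.1 = a
              · have h1 := hNa p.1 (hq ▸ hpq'.symm)
                simp only [Finset.mem_insert, Finset.mem_singleton, hpx, false_or] at h1
                simp only [hp, hq, dite_true, dite_false, delVert_adj]
                rw [h1]
                exact hbc.symm
              · simp only [hp, hq, dite_false, delVert_adj]
                exact hpq' }
      have hreach : ∀ y : {y // y ≠ a}, (delVert G a).Reachable ⟨b, hab.symm⟩ y := by
        intro y
        by_cases hy : y.1 = x
        · refine SimpleGraph.Adj.reachable ?_
          change G.Adj b y.1
          rw [hy]
          exact hxb.symm
        · have h1 := (hc.preconnected ⟨b, hxb.ne'⟩ ⟨y.1, hy⟩).map φ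
          have h2 : φ ⟨b, hxb.ne'⟩ = ⟨b, hab.symm⟩ := dif_neg hab.symm
          have h3 : φ ⟨y.1, hy⟩ = y := dif_neg y.2
          rwa [h2, h3] at h1
      have : Nonempty {y // y ≠ a} := ⟨⟨b, hab.symm⟩⟩
      exact ⟨fun p q => (hreach p).symm.trans (hreach q)⟩
    refine hclosed fun y hy => ?_
    by_contra hne
    push Not at hne
    have hyx : y ≠ x := by
      rintro rfl
      rcases (hN c).1 hy.symm with h | h
      · exact hca h
      · exact hcb h
    refine hne.2 (layer a hva hconn y b ?_ (dist_eq_two G hG hxa.symm hxb hab hadj))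
    refine dist_eq_two G hG hac hy hne.1.symm fun h => ?_
    have h1 := hNa y h
    simp only [Finset.mem_insert, Finset.mem_singleton] at h1
    rcases h1 with h1 | h1
    · exact hyx h1
    · exact hy.ne' h1

theorem exists_iso_B33 (m : ℕ) (G : SimpleGraph V) (hG : G.Connected)
    (hdeg : ∀ v, 2 ≤ valency G v) (hcard : Fintype.card V = m + 1)
    (hs : ∑ v, valency G v = 2 * (m + 1) + 2) (hm : 4 ≤ m)
    (hsmall : ∀ x, valency G x = 2 → (delVert G x).Connected →
      (univ.filter fun y => G.dist x y = 2).card ≤ 1) : Nonempty (G ≃g B33 (m + 1)) := by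
  have htri := exists_triangle G hG hdeg (by omega) (by omega) hsmall
  have hne2 := card_valency_ne_two_le G hdeg (by omega)
  obtain ⟨x, hvx, hcx⟩ := exists_valency_two_delVert_connected G hG (by omega) hne2
  obtain ⟨a, b, hxa, hxb, hab, hvb, hva⟩ := htri x hvx hcx
  have hNx : ∀ y, G.Adj x y → y = a ∨ y = b := fun y hy => by
    simpa using mem_of_valency_le_card G x {a, b} (by simp [hxa, hxb])
      (by rw [Finset.card_pair hab.ne, hvx]) y hy
  have hNb : ∀ y, G.Adj b y → y = x ∨ y = a := fun y hy => by
    simpa using mem_of_valency_le_card G b {x, a} (by simp [hxb.symm, hab.symm])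
      (by rw [Finset.card_pair hxa.ne, hvb]) y hy
  have hcardU := card_ne_add_one x
  have hsumU := sum_valency_delVert G x
  have hvUb : valency (delVert G x) ⟨b, hxb.ne'⟩ = 1 := by
    have h := valency_delVert G x ⟨b, hxb.ne'⟩
    rw [if_pos hxb] at h
    simp only at h
    omega
  have hvUa : valency (delVert G x) ⟨a, hxa.ne'⟩ = 2 := by
    have h := valency_delVert G x ⟨a, hxa.ne'⟩
    rw [if_pos hxa] at h
    simp only at h
    omega
  have hvU : ∀ y : {y // y ≠ x}, y.1 ≠ a → y.1 ≠ b → valency (delVert G x) y = valency G y.1 := by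
    intro y h1 h2
    have h := valency_delVert G x y
    rw [if_neg fun k => (hNx _ k).elim h1 h2] at h
    exact h.symm
  have hUne2 : (univ.filter fun v => valency (delVert G x) v ≠ 2).card ≤ 2 := by
    have h1 : (univ.filter fun v => valency (delVert G x) v ≠ 2).card ≤
        (insert b ((univ.filter fun v => valency G v ≠ 2).erase a)).card := by
      rw [← Finset.card_map ⟨Subtype.val, Subtype.val_injective⟩]
      refine Finset.card_le_card fun v hv => ?_
      simp only [Finset.mem_map, Finset.mem_filter, Finset.mem_univ, true_and,
        Function.Embedding.coeFn_mk] at hv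
      obtain ⟨y, hy, rfl⟩ := hv
      simp only [Finset.mem_insert, Finset.mem_erase, Finset.mem_filter, Finset.mem_univ, true_and]
      by_cases hyb : y.1 = b
      · exact Or.inl hyb
      · have hya : y.1 ≠ a := fun h => hy (by
          rw [show y = ⟨a, hxa.ne'⟩ from Subtype.ext h]
          exact hvUa)
        exact Or.inr ⟨hya, by rwa [← hvU y hya hyb]⟩
    have h2 := Finset.card_insert_le b ((univ.filter fun v => valency G v ≠ 2).erase a)
    rw [Finset.card_erase_of_mem (by simp [hva])] at h2
    omega
  obtain ⟨y, hvy, hcy⟩ :=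
    exists_valency_two_delVert_connected (delVert G x) hcx (by omega) hUne2
  have hyb : y.1 ≠ b := fun h => by
    rw [show y = ⟨b, hxb.ne'⟩ from Subtype.ext h] at hvy
    omega
  have hya : y.1 ≠ a := fun h => by
    have h1 : y = ⟨a, hxa.ne'⟩ := Subtype.ext h
    have h2 := two_le_valency_of_adj (delVert G x) (by omega) y hcy ⟨b, hxb.ne'⟩ (by
      rw [h1]
      exact hab)
    omega
  have hvyG : valency G y.1 = 2 := by rw [← hvU y hya hyb, hvy]
  have hcyG : (delVert G y.1).Connected := by
    let φ : delVert (delVert G x) y →g delVert G y.1 :=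
      { toFun := fun v => ⟨v.1.1, fun h => v.2 (Subtype.ext h)⟩
        map_rel' := fun h => h }
    have hreach : ∀ z : {z // z ≠ y.1}, (delVert G y.1).Reachable ⟨b, hyb.symm⟩ z := by
      intro z
      by_cases hz : z.1 = x
      · refine SimpleGraph.Adj.reachable ?_
        change G.Adj b z.1
        rw [hz]
        exact hxb.symm
      · exact (hcy.preconnected ⟨⟨b, hxb.ne'⟩, fun h => hyb (congrArg Subtype.val h).symm⟩
          ⟨⟨z.1, hz⟩, fun h => z.2 (congrArg Subtype.val h)⟩).map φ
    have : Nonempty {z // z ≠ y.1} := ⟨⟨b, hyb.symm⟩⟩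
    exact ⟨fun p q => (hreach p).symm.trans (hreach q)⟩
  obtain ⟨c, d, hyc, hyd, hcd, hvd, hvc⟩ := htri y.1 hvyG hcyG
  have hcx' : c ≠ x := by rintro rfl; omega
  have hdx : d ≠ x := by
    rintro rfl
    rcases hNx _ hyd.symm with h | h
    · exact hya h
    · exact hyb h
  have hda : d ≠ a := by rintro rfl; omega
  have hdb : d ≠ b := by
    rintro rfl
    rcases hNb _ hyd.symm with h | h
    · exact y.2 h
    · exact hya h
  obtain ⟨e, he⟩ := exists_iso_kite m _ (delVert G x) ⟨b, hxb.ne'⟩ y ⟨d, hdx⟩ ⟨c, hcx'⟩ hcx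
    (by omega) (by omega)
    (by
      intro v hv
      by_cases hva' : v.1 = a
      · rw [show v = ⟨a, hxa.ne'⟩ from Subtype.ext hva', hvUa]
      · rw [hvU v hva' fun h => hv (Subtype.ext h)]
        exact hdeg _)
    hyd hyc hcd.symm hvy ((hvU ⟨d, hdx⟩ hda hdb).trans hvd)
  have hea : (e ⟨a, hxa.ne'⟩).val = 1 := by
    have h1 : (kite m).Adj (e ⟨b, hxb.ne'⟩) (e ⟨a, hxa.ne'⟩) := e.map_adj_iff.2 hab.symm
    simp only [kite, SimpleGraph.fromRel_adj] at h1
    omega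
  obtain ⟨f, -⟩ := exists_iso_of_delVert_iso G x (B33 (m + 1)) e 0 Fin.succ
    (Fin.succ_injective m) (fun i => Fin.succ_ne_zero i) (B33_succ_adj m hm) (by
      intro z
      rw [B33_zero_adj m hm, ← he, ← hea, ← Fin.ext_iff, ← Fin.ext_iff, e.injective.eq_iff,
        e.injective.eq_iff, Subtype.ext_iff, Subtype.ext_iff]
      constructor
      · rintro (h | h)
        · rw [h]; exact hxb
        · rw [h]; exact hxa
      · intro h
        exact (hNx _ h).symm)
  exact ⟨f⟩

/-- A bicyclic graph without pendant vertices. -/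
theorem pairDistSum_le_or_iso_B33 (m : ℕ) (G : SimpleGraph V) (hG : G.Connected)
    (hdeg : ∀ v, 2 ≤ valency G v) (hcard : Fintype.card V = m + 1)
    (hs : ∑ v, valency G v = 2 * (m + 1) + 2) (hm : 4 ≤ m) :
    Nonempty (G ≃g B33 (m + 1)) ∨
      (3 * pairDistSum G ≤ ((m : ℤ) + 1) * m * (m - 1) + 3 * ((m : ℤ) ^ 2 - 5 * m + 12) ∧
        (6 ≤ m →
          3 * pairDistSum G < ((m : ℤ) + 1) * m * (m - 1) + 3 * ((m : ℤ) ^ 2 - 5 * m + 12))) := by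
  by_cases hsmall : ∀ x, valency G x = 2 → (delVert G x).Connected →
      (univ.filter fun y => G.dist x y = 2).card ≤ 1
  · exact Or.inl (exists_iso_B33 m G hG hdeg hcard hs hm hsmall)
  · push Not at hsmall
    obtain ⟨x, hvx, hcx, h2⟩ := hsmall
    have h3 := card_ne_add_one x
    have h4 := sum_valency_delVert G x
    have h5 := pairDistSum_le_delVert G x hcx
    have h6 := pairDistSum_le_of_unicyclic m _ (delVert G x) hcx (by omega) (by omega)
    refine Or.inr ⟨?_, fun hm6 => ?_⟩
    · have h7 := distSum_le_of_second_layer G hG x hvx h2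
      rw [hcard] at h7
      push_cast at h7
      nlinarith
    · have h7 := distSum_lt_of_second_layer G hG x hvx h2 hdeg (by omega)
      rw [hcard] at h7
      push_cast at h7
      nlinarith

end NoPendant

section Classification

universe u

theorem distSum_Bgraph_zero_le (k : ℕ) (hk : 3 ≤ k) (i : Fin (k + 1)) (h0 : i.val ≠ 0)
    (h1 : i.val ≠ k - 1) :
    2 * distSum (Bgraph (k + 1) 0) i + 2 * (k - 3) ≤ (k : ℤ) ^ 2 + k - 6 ∧
      (4 ≤ k → 2 * distSum (Bgraph (k + 1) 0) i + 2 * (k - 3) < (k : ℤ) ^ 2 + k - 6) := by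
  obtain ⟨i, hi⟩ := i
  simp only at h0 h1
  rcases (by omega : i = k ∨ i < k - 1) with rfl | hlt
  · have h2 := distSum_Bgraph_last i 0 (by omega)
    have h3 := two_mul_lineSum (i - 2 - 0) i (by omega)
    obtain ⟨t, rfl⟩ : ∃ t, i = t + 3 := ⟨i - 3, by omega⟩
    rw [show t + 3 - 2 - 0 = t + 1 by omega] at h2 h3
    rw [h2]
    push_cast at h3 ⊢
    exact ⟨by nlinarith, fun h => by
      have : (1 : ℤ) ≤ t := by exact_mod_cast (by omega : 1 ≤ t)
      nlinarith⟩
  · obtain ⟨p, rfl⟩ : ∃ p, i = p + 1 := ⟨i - 1, by omega⟩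
    obtain ⟨j, rfl⟩ : ∃ j, k = p + j + 3 := ⟨k - p - 3, by omega⟩
    have h2 := distSum_Bgraph (p + j + 3) 0 (p + 1) (by omega) (by omega)
    have h3 := two_mul_lineSum (p + 1) (p + j + 3) (by omega)
    have h4 : gap (p + 1) (p + j + 3 - 2 - 0) = j := by unfold gap; omega
    have h6 : (0 : ℤ) ≤ p * j := by positivity
    rw [h2, h4]
    push_cast at h3 ⊢
    split_ifs with h5
    · obtain rfl : j = 0 := by omega
      push_cast at h3 ⊢
      exact ⟨by nlinarith, fun h => by
        have : (1 : ℤ) ≤ p := by exact_mod_cast (by omega : 1 ≤ p)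
        nlinarith⟩
    · have h7 : (1 : ℤ) ≤ j := by exact_mod_cast (by omega : 1 ≤ j)
      exact ⟨by nlinarith, fun h => by nlinarith⟩

theorem distSum_Bgraph_one_le (k : ℕ) (hk : 5 ≤ k) (i : Fin (k + 1)) (h0 : i.val ≠ 0)
    (h1 : ¬ (k = 5 ∧ i.val = 4)) :
    2 * distSum (Bgraph (k + 1) 1) i + 2 ≤ (k : ℤ) ^ 2 + k - 6 ∧
      (k ≠ 6 → 2 * distSum (Bgraph (k + 1) 1) i + 2 < (k : ℤ) ^ 2 + k - 6) := by
  obtain ⟨i, hi⟩ := i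
  simp only at h0 h1
  rcases (by omega : i = k ∨ i + 1 = k ∨ i + 2 = k ∨ i + 3 = k ∨ i + 3 < k) with
    rfl | h | h | h | h
  · have h2 := distSum_Bgraph_last i 1 (by omega)
    have h3 := two_mul_lineSum (i - 2 - 1) i (by omega)
    obtain ⟨t, rfl⟩ : ∃ t, i = t + 5 := ⟨i - 5, by omega⟩
    rw [show t + 5 - 2 - 1 = t + 2 by omega] at h2 h3
    rw [h2]
    push_cast at h3 ⊢
    exact ⟨by nlinarith, fun _ => by nlinarith⟩
  · have h2 := distSum_Bgraph k 1 i (by omega) (by omega)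
    have h3 := two_mul_lineSum i k (by omega)
    obtain ⟨t, rfl⟩ : ∃ t, i = t + 5 := ⟨i - 5, by omega⟩
    subst h
    have h4 : gap (t + 5) (t + 5 + 1 - 2 - 1) = 2 := by unfold gap; omega
    rw [h2, h4, if_neg (by omega)]
    push_cast at h3 ⊢
    exact ⟨by nlinarith, fun h => by
      have : (1 : ℤ) ≤ t := by exact_mod_cast (by omega : 1 ≤ t)
      nlinarith⟩
  · have h2 := distSum_Bgraph k 1 i (by omega) (by omega)
    have h3 := two_mul_lineSum i k (by omega)
    obtain ⟨t, rfl⟩ : ∃ t, i = t + 3 := ⟨i - 3, by omega⟩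
    subst h
    have h4 : gap (t + 3) (t + 3 + 2 - 2 - 1) = 1 := by unfold gap; omega
    rw [h2, h4, if_neg (by omega)]
    push_cast at h3 ⊢
    exact ⟨by nlinarith, fun _ => by nlinarith⟩
  · have h2 := distSum_Bgraph k 1 i (by omega) (by omega)
    have h3 := two_mul_lineSum i k (by omega)
    obtain ⟨t, rfl⟩ : ∃ t, i = t + 2 := ⟨i - 2, by omega⟩
    subst h
    have h4 : gap (t + 2) (t + 2 + 3 - 2 - 1) = 0 := by unfold gap; omega
    rw [h2, h4, if_pos (by omega)]
    push_cast at h3 ⊢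
    exact ⟨by nlinarith, fun _ => by nlinarith⟩
  · obtain ⟨p, rfl⟩ : ∃ p, i = p + 1 := ⟨i - 1, by omega⟩
    obtain ⟨j, rfl⟩ : ∃ j, k = p + j + 5 := ⟨k - p - 5, by omega⟩
    have h2 := distSum_Bgraph (p + j + 5) 1 (p + 1) (by omega) (by omega)
    have h3 := two_mul_lineSum (p + 1) (p + j + 5) (by omega)
    have h4 : gap (p + 1) (p + j + 5 - 2 - 1) = j + 1 := by unfold gap; omega
    have h6 : (0 : ℤ) ≤ p * j := by positivity
    rw [h2, h4, if_neg (by omega)]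
    push_cast at h3 ⊢
    exact ⟨by nlinarith, fun _ => by nlinarith⟩

theorem distSum_B33_lt (k : ℕ) (hk : 3 ≤ k) (i : Fin (k + 2)) :
    2 * distSum (B33 (k + 2)) i < (k : ℤ) ^ 2 + k + 2 := by
  obtain ⟨i, hi⟩ := i
  rcases (by omega : i = 0 ∨ i = k + 1 ∨ (0 < i ∧ i ≤ k)) with rfl | rfl | ⟨hi0, hik⟩
  · have h2 := distSum_B33_first k hk
    have h3 := two_mul_lineSum 0 k (by omega)
    rw [h2]
    push_cast at h3 ⊢
    nlinarith
  · have h2 := distSum_B33_last k hk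
    have h3 := two_mul_lineSum (k - 1) k (by omega)
    rw [h2]
    rw [Nat.cast_sub (by omega)] at h3
    push_cast at h3 ⊢
    nlinarith
  · obtain ⟨j, rfl⟩ : ∃ j, i = j + 1 := ⟨i - 1, by omega⟩
    have h2 := distSum_B33 k j hk (by omega)
    have h3 := two_mul_lineSum j k (by omega)
    rw [h2]
    obtain ⟨p, rfl⟩ : ∃ p, k = j + 1 + p := ⟨k - j - 1, by omega⟩
    have h6 : (0 : ℤ) ≤ p * j := by positivity
    push_cast at h3 ⊢
    split_ifs with h4 h5 h5
    · omega
    · subst h4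
      push_cast at *
      nlinarith
    · obtain rfl : p = 0 := by omega
      push_cast at *
      nlinarith
    · have h7 : (1 : ℤ) ≤ p := by exact_mod_cast (by omega : 1 ≤ p)
      have h8 : (1 : ℤ) ≤ j := by exact_mod_cast (by omega : 1 ≤ j)
      nlinarith

section Attachments

theorem Bgraph_adj (n r s : ℕ) (hn : n = r + s + 4) (i j : Fin n) : (Bgraph n s).Adj i j ↔
    (i.val + 1 = j.val ∧ j.val < r + s + 3) ∨ (j.val = r + s + 3 ∧ r ≤ i.val ∧ i.val ≤ r + 2) ∨
    (j.val + 1 = i.val ∧ i.val < r + s + 3) ∨ (i.val = r + s + 3 ∧ r ≤ j.val ∧ j.val ≤ r + 2) := by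
  simp only [Bgraph, SimpleGraph.fromRel_adj, ne_eq, Fin.ext_iff,
    show n - s - 4 = r by omega, show n - s - 3 = r + 1 by omega,
    show n - s - 2 = r + 2 by omega, show n - 2 = r + s + 2 by omega,
    show n - 1 = r + s + 3 by omega]
  constructor <;> intro h <;> omega

variable {V : Type*} [Fintype V]

/-- Attaching a pendant vertex at the free vertex of degree two of `B(r+4,0)`. -/
theorem exists_iso_Bgraph_one (G : SimpleGraph V) (v : V) (r : ℕ)
    (e : delVert G v ≃g Bgraph (r + 4) 0) (w : {y // y ≠ v}) (hw : ∀ y, G.Adj v y ↔ y = w.1)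
    (he : (e w).val = r + 2) : Nonempty (G ≃g Bgraph (r + 4 + 1) 1) := by
  have hσ : ∀ i : Fin (r + 4), (if i.val = r + 3 then r + 4 else i.val) < r + 4 + 1 := by
    intro i
    split_ifs <;> omega
  obtain ⟨f, -⟩ := exists_iso_of_pendant G v (Bgraph (r + 4 + 1) 1) e w hw ⟨r + 3, by omega⟩
    (fun i => ⟨if i.val = r + 3 then r + 4 else i.val, hσ i⟩)
    (by
      rintro ⟨i, hi⟩ ⟨j, hj⟩ h
      simp only [Fin.mk.injEq] at h ⊢
      split_ifs at h <;> omega)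
    (by
      rintro ⟨i, hi⟩ h
      simp only [Fin.mk.injEq] at h
      split_ifs at h <;> omega)
    (by
      rintro ⟨i, hi⟩ ⟨j, hj⟩
      rw [Bgraph_adj _ r 1 (by omega), Bgraph_adj _ r 0 (by omega)]
      simp only
      split_ifs <;> constructor <;> intro h <;> omega)
    (by
      rintro ⟨i, hi⟩
      rw [Bgraph_adj _ r 1 (by omega), Fin.ext_iff, he]
      simp only
      split_ifs <;> constructor <;> intro h <;> omega)
  exact ⟨f⟩

/-- Attaching a pendant vertex at the other end of the symmetric graph `B(2s+4,s)`. -/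
theorem exists_iso_Bgraph_symm (G : SimpleGraph V) (v : V) (s : ℕ)
    (e : delVert G v ≃g Bgraph (2 * s + 4) s) (w : {y // y ≠ v})
    (hw : ∀ y, G.Adj v y ↔ y = w.1) (he : (e w).val = 2 * s + 2) :
    Nonempty (G ≃g Bgraph (2 * s + 4 + 1) s) := by
  have hσ : ∀ i : Fin (2 * s + 4),
      (if i.val = 2 * s + 3 then 2 * s + 4 else 2 * s + 2 - i.val + 1) < 2 * s + 4 + 1 := by
    intro i
    split_ifs <;> omega
  obtain ⟨f, -⟩ := exists_iso_of_pendant G v (Bgraph (2 * s + 4 + 1) s) e w hw ⟨0, by omega⟩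
    (fun i => ⟨if i.val = 2 * s + 3 then 2 * s + 4 else 2 * s + 2 - i.val + 1, hσ i⟩)
    (by
      rintro ⟨i, hi⟩ ⟨j, hj⟩ h
      simp only [Fin.mk.injEq] at h ⊢
      split_ifs at h <;> omega)
    (by
      rintro ⟨i, hi⟩ h
      simp only [Fin.mk.injEq] at h
      split_ifs at h)
    (by
      rintro ⟨i, hi⟩ ⟨j, hj⟩
      rw [Bgraph_adj _ (s + 1) s (by omega), Bgraph_adj _ s s (by omega)]
      simp only
      split_ifs <;> constructor <;> intro h <;> omega)
    (by
      rintro ⟨i, hi⟩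
      rw [Bgraph_adj _ (s + 1) s (by omega), Fin.ext_iff, he]
      simp only
      generalize hc : (if i = 2 * s + 3 then 2 * s + 4 else 2 * s + 2 - i + 1) = c
      split_ifs at hc <;> constructor <;> intro h <;> omega)
  exact ⟨f⟩

end Attachments

end Classification

section Main

universe u

/-- Six times the Wiener index of `B_n^{(1)}`. -/
def wienerBound (n : ℕ) : ℤ := (n : ℤ) * (n - 1) * (n - 2) + 3 * ((n : ℤ) ^ 2 - 7 * n + 18)

theorem wienerBound_succ (m : ℕ) : wienerBound (m + 1) = wienerBound m + 6 * m + 3 * ((m : ℤ) ^ 2 - m - 6) := by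
  simp only [wienerBound]
  push_cast
  ring

theorem three_mul_pairDistSum_Bgraph_zero (n : ℕ) (hn : 4 ≤ n) :
    3 * pairDistSum (Bgraph n 0) = wienerBound n + 6 * (n - 4) := by
  obtain ⟨k, rfl⟩ : ∃ k, n = k + 2 + 1 := ⟨n - 3, by omega⟩
  have h := two_mul_lineSum k (k + 2) (by omega)
  rw [pairDistSum_Bgraph (k + 2) 0 (by omega), show k + 2 - 2 - 0 = k by omega]
  simp only [wienerBound]
  push_cast at h ⊢
  linear_combination 3 * h

theorem three_mul_pairDistSum_Bgraph_one (n : ℕ) (hn : 5 ≤ n) :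
    3 * pairDistSum (Bgraph n 1) = wienerBound n + 6 := by
  obtain ⟨k, rfl⟩ : ∃ k, n = k + 3 + 1 := ⟨n - 4, by omega⟩
  have h := two_mul_lineSum k (k + 3) (by omega)
  rw [pairDistSum_Bgraph (k + 3) 1 (by omega), show k + 3 - 2 - 1 = k by omega]
  simp only [wienerBound]
  push_cast at h ⊢
  linear_combination 3 * h

theorem three_mul_pairDistSum_B33 (n : ℕ) (hn : 5 ≤ n) :
    3 * pairDistSum (B33 n) = wienerBound n + 6 * (n - 5) := by
  obtain ⟨k, rfl⟩ : ∃ k, n = k + 2 := ⟨n - 2, by omega⟩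
  rw [pairDistSum_B33 k (by omega)]
  simp only [wienerBound]
  push_cast
  ring

theorem three_mul_pairDistSum_Bn1 (n : ℕ) (hn : 4 ≤ n) : 3 * pairDistSum (Bn1 n) = wienerBound n := by
  obtain ⟨k, rfl⟩ : ∃ k, n = k + 2 := ⟨n - 2, by omega⟩
  rw [pairDistSum_Bn1 k (by omega)]
  simp only [wienerBound]
  push_cast
  ring

/-- Either one of the four extremal bicyclic graphs, or a bicyclic graph of smaller Wiener index.
-/
theorem exists_iso_or_pairDistSum_le (n : ℕ) : ∀ (V : Type u) [Fintype V] (G : SimpleGraph V),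
    G.Connected → Fintype.card V = n → ∑ v, valency G v = 2 * n + 2 → 4 ≤ n →
    Nonempty (G ≃g Bgraph n 0) ∨ (6 ≤ n ∧ Nonempty (G ≃g Bgraph n 1)) ∨
    Nonempty (G ≃g Bn1 n) ∨ (5 ≤ n ∧ Nonempty (G ≃g B33 n)) ∨
    (3 * pairDistSum G ≤ wienerBound n ∧ (7 ≤ n → n ≠ 8 → 3 * pairDistSum G < wienerBound n)) := by
  induction n with
  | zero => intro V _ G _ _ _ h; omega
  | succ m ih =>
    intro V _ G hG hcard hs hm
    rcases (by omega : m = 3 ∨ 4 ≤ m) with rfl | hm4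
    · obtain ⟨w⟩ := hG.nonempty
      rcases exists_iso_of_card_four G w hcard hs with ⟨e, -⟩ | ⟨e, -⟩
      · exact Or.inl ⟨e⟩
      · exact Or.inr (Or.inr (Or.inl ⟨e⟩))
    by_cases hdeg : ∀ v, 2 ≤ valency G v
    · rcases pairDistSum_le_or_iso_B33 m G hG hdeg hcard hs hm4 with h | ⟨h1, h2⟩
      · exact Or.inr (Or.inr (Or.inr (Or.inl ⟨by omega, h⟩)))
      · have h3 : wienerBound (m + 1) =
            ((m : ℤ) + 1) * m * (m - 1) + 3 * ((m : ℤ) ^ 2 - 5 * m + 12) := by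
          simp only [wienerBound]
          push_cast
          ring
        rw [h3]
        exact Or.inr (Or.inr (Or.inr (Or.inr ⟨h1, fun h _ => h2 (by omega)⟩)))
    push Not at hdeg
    obtain ⟨v, hv⟩ := hdeg
    have hv1 : valency G v = 1 := by
      have := valency_pos G hG (by omega) v
      omega
    obtain ⟨w, hw⟩ := exists_unique_neighbor G v hv1
    have hc := delVert_connected_of_valency_one G hG v hv1
    have hcardH := card_ne_add_one v
    have hsumH := sum_valency_delVert G v
    have hle : pairDistSum G ≤ 2 * (m + distSum (delVert G v) w) + pairDistSum (delVert G v) := by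
      have h1 := pairDistSum_le_delVert G v hc
      have h2 := distSum_le_delVert G hG v w ((hw _).2 rfl) hc
      rw [hcard] at h2
      push_cast at h2
      linarith
    have hsucc := wienerBound_succ m
    have hrest : 3 * pairDistSum (delVert G v) ≤ wienerBound m →
        Nonempty (G ≃g Bgraph (m + 1) 0) ∨ (6 ≤ m + 1 ∧ Nonempty (G ≃g Bgraph (m + 1) 1)) ∨
        Nonempty (G ≃g Bn1 (m + 1)) ∨ (5 ≤ m + 1 ∧ Nonempty (G ≃g B33 (m + 1))) ∨
        (3 * pairDistSum G ≤ wienerBound (m + 1) ∧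
          (7 ≤ m + 1 → m + 1 ≠ 8 → 3 * pairDistSum G < wienerBound (m + 1))) := by
      intro hH
      by_cases hD : (m : ℤ) ^ 2 - m - 6 ≤ 2 * distSum (delVert G v) w
      · rcases exists_rooted_iso m _ (delVert G v) w hc (by omega) (by omega) hm4 hD with
          ⟨e, he⟩ | ⟨h5, e, he⟩ | ⟨e, he⟩
        · obtain ⟨f, -⟩ := exists_iso_of_pendant_zero G v _ e w hw he (Bgraph_succ_adj m 0 hm4)
            (Bgraph_zero_adj m 0 hm4)
          exact Or.inl ⟨f⟩
        · obtain ⟨f, -⟩ := exists_iso_of_pendant_zero G v _ e w hw he (Bgraph_succ_adj m 1 h5)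
            (Bgraph_zero_adj m 1 h5)
          exact Or.inr (Or.inl ⟨by omega, ⟨f⟩⟩)
        · obtain ⟨f, -⟩ := exists_iso_of_pendant_zero G v _ e w hw he (Bn1_succ_adj m hm4)
            (Bn1_zero_adj m hm4)
          exact Or.inr (Or.inr (Or.inl ⟨f⟩))
      · push Not at hD
        have h : 3 * pairDistSum G < wienerBound (m + 1) := by linarith
        exact Or.inr (Or.inr (Or.inr (Or.inr ⟨h.le, fun _ _ => h⟩)))
    rcases ih _ (delVert G v) hc (by omega) (by omega) hm4 with
      ⟨⟨e⟩⟩ | ⟨h6, ⟨e⟩⟩ | ⟨⟨e⟩⟩ | ⟨h5, ⟨e⟩⟩ | ⟨h, -⟩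
    · have hp := pairDistSum_iso e hc
      have hd := distSum_iso e hc w
      have hval := three_mul_pairDistSum_Bgraph_zero m hm4
      by_cases h0 : (e w).val = 0
      · obtain ⟨f, -⟩ := exists_iso_of_pendant_zero G v _ e w hw h0 (Bgraph_succ_adj m 0 hm4)
          (Bgraph_zero_adj m 0 hm4)
        exact Or.inl ⟨f⟩
      by_cases h2 : (e w).val = m - 2
      · rcases (by omega : m = 4 ∨ 5 ≤ m) with rfl | h5
        · exact Or.inl (exists_iso_Bgraph_symm G v 0 e w hw h2)
        · obtain ⟨r, rfl⟩ : ∃ r, m = r + 4 := ⟨m - 4, by omega⟩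
          exact Or.inr (Or.inl ⟨by omega, exists_iso_Bgraph_one G v r e w hw (by omega)⟩)
      obtain ⟨k, rfl⟩ : ∃ k, m = k + 1 := ⟨m - 1, by omega⟩
      have hb := distSum_Bgraph_zero_le k (by omega) (e w) h0 (by omega)
      rw [hp] at hval
      rw [hd] at hb
      push_cast at *
      refine Or.inr (Or.inr (Or.inr (Or.inr ⟨?_, fun h7 _ => ?_⟩)))
      · linarith [hb.1]
      · linarith [hb.2 (by omega)]
    · have hp := pairDistSum_iso e hc
      have hd := distSum_iso e hc w
      have hval := three_mul_pairDistSum_Bgraph_one m (by omega)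
      by_cases h0 : (e w).val = 0
      · obtain ⟨f, -⟩ := exists_iso_of_pendant_zero G v _ e w hw h0
          (Bgraph_succ_adj m 1 (by omega)) (Bgraph_zero_adj m 1 (by omega))
        exact Or.inr (Or.inl ⟨by omega, ⟨f⟩⟩)
      by_cases h2 : m = 6 ∧ (e w).val = 4
      · obtain ⟨rfl, h2⟩ := h2
        exact Or.inr (Or.inl ⟨by omega, exists_iso_Bgraph_symm G v 1 e w hw h2⟩)
      obtain ⟨k, rfl⟩ : ∃ k, m = k + 1 := ⟨m - 1, by omega⟩
      have hb := distSum_Bgraph_one_le k (by omega) (e w) h0 (by omega)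
      rw [hp] at hval
      rw [hd] at hb
      push_cast at *
      refine Or.inr (Or.inr (Or.inr (Or.inr ⟨?_, fun _ h8 => ?_⟩)))
      · linarith [hb.1]
      · linarith [hb.2 (by omega)]
    · refine hrest (le_of_eq ?_)
      rw [← pairDistSum_iso e hc, three_mul_pairDistSum_Bn1 m hm4]
    · have hp := pairDistSum_iso e hc
      have hd := distSum_iso e hc w
      have hval := three_mul_pairDistSum_B33 m h5
      obtain ⟨k, rfl⟩ : ∃ k, m = k + 2 := ⟨m - 2, by omega⟩
      have hb := distSum_B33_lt k (by omega) (e w)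
      rw [hp] at hval
      rw [hd] at hb
      have h : 3 * pairDistSum G < wienerBound (k + 2 + 1) := by
        push_cast at *
        linarith
      exact Or.inr (Or.inr (Or.inr (Or.inr ⟨h.le, fun _ _ => h⟩)))
    · exact hrest h

end Main

/-- Bicyclic graphs of order `n ≥ 7`, `n ≠ 8`, outside
`{B(n,0), B(n,1), B_n^{(1)}, B_n^{3,3}}`: the first four largest Wiener indices. -/
theorem bicyclic_wiener_first_four_largest
    {V : Type*} [Fintype V] (G : SimpleGraph V) (n : ℕ)
    (hcard : Fintype.card V = n) (hn : 7 ≤ n) (hn8 : n ≠ 8)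
    (hconn : G.Connected) (hbic : G.edgeSet.ncard = n + 1)
    (hB1 : ¬ Nonempty (G ≃g Bgraph n 0)) (hB2 : ¬ Nonempty (G ≃g Bgraph n 1))
    (hB3 : ¬ Nonempty (G ≃g Bn1 n)) (hB4 : ¬ Nonempty (G ≃g B33 n)) :
    wienerIndex G < wienerIndex (Bn1 n) ∧
    wienerIndex (Bn1 n) < wienerIndex (Bgraph n 1) ∧
    wienerIndex (Bgraph n 1) < wienerIndex (B33 n) ∧
    wienerIndex (B33 n) < wienerIndex (Bgraph n 0) := by
  have h0 := three_mul_pairDistSum_Bgraph_zero n (by omega)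
  have h1 := three_mul_pairDistSum_Bgraph_one n (by omega)
  have h2 := three_mul_pairDistSum_Bn1 n (by omega)
  have h3 := three_mul_pairDistSum_B33 n (by omega)
  have h4 : 3 * pairDistSum G < wienerBound n := by
    rcases exists_iso_or_pairDistSum_le n V G hconn hcard
      (by rw [sum_valency_eq, hbic]; ring) (by omega) with h | ⟨-, h⟩ | h | ⟨-, h⟩ | ⟨-, h⟩
    · exact absurd h hB1
    · exact absurd h hB2
    · exact absurd h hB3
    · exact absurd h hB4
    · exact h hn hn8
  have hn' : (7 : ℤ) ≤ n := by exact_mod_cast hn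
  have hlt : ∀ a b : ℤ, a < b → (a : ℚ) / 2 < (b : ℚ) / 2 := fun a b h => by
    have : (a : ℚ) < b := by exact_mod_cast h
    linarith
  simp only [wienerIndex_eq_pairDistSum]
  exact ⟨hlt _ _ (by linarith), hlt _ _ (by linarith), hlt _ _ (by linarith),
    hlt _ _ (by linarith)⟩
end
end

section
/- Let G be a bicyclic graph of order 8 that is not isomorphic to any of B(8,0), B(8,1), B(8,2), B_8^{(1)}, B_8^{3,3}. Then W(G) < W(B(8,2)) = W(B_8^{(1)}) < W(B(8,1)) < W(B_8^{3,3}) < W(B(8,0)). -/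
open SimpleGraph Finset
open scoped Classical

noncomputable section

namespace BitMatrix

/-- The number `1 + 256 + ⋯ + 256 ^ (n - 1)`, with one bit set at the start of each byte. -/
def repunit : ℕ → ℕ
  | 0 => 0
  | n + 1 => 2 ^ 8 * repunit n + 1

theorem land_repunit_succ (x n : ℕ) :
    x &&& repunit (n + 1) = 2 ^ 8 * ((x >>> 8) &&& repunit n) + (x.testBit 0).toNat := by
  apply Nat.eq_of_testBit_eq
  intro t
  have hb : (x.testBit 0).toNat < 2 ^ 8 := by cases x.testBit 0 <;> simp
  rw [Nat.testBit_and, repunit, Nat.testBit_two_pow_mul_add _ (by norm_num),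
    Nat.testBit_two_pow_mul_add _ hb]
  split_ifs with h
  · rcases Nat.eq_zero_or_pos t with rfl | ht
    · cases x.testBit 0 <;> simp
    · have h1 : Nat.testBit 1 t = false := by
        simpa [ht.ne] using Nat.testBit_two_pow (n := 0) (m := t)
      cases x.testBit 0 <;> simp [h1]
  · rw [Nat.testBit_and, Nat.testBit_shiftRight, Nat.add_sub_cancel' (not_lt.mp h)]

theorem testBit_land_repunit_mul {r t : ℕ} (hr : r < 2 ^ 8) (ht : t < 8) (x n i : ℕ) :
    ((x &&& repunit n) * r).testBit (8 * i + t) =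
      (decide (i < n) && x.testBit (8 * i) && r.testBit t) := by
  induction n generalizing x i with
  | zero => simp [repunit]
  | succ n ih =>
    have hb : (x.testBit 0).toNat * r < 2 ^ 8 := by
      cases x.testBit 0
      · simp
      · simpa using hr
    rw [land_repunit_succ, add_mul, mul_assoc, Nat.testBit_two_pow_mul_add _ hb]
    cases i with
    | zero => rw [if_pos (by omega)]; cases h : x.testBit 0 <;> simp
    | succ i =>
      rw [if_neg (by omega), show 8 * (i + 1) + t - 8 = 8 * i + t by omega, ih,
        Nat.testBit_shiftRight, show 8 + 8 * i = 8 * (i + 1) by ring]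
      simp

theorem land_repunit_modEq (x n : ℕ) :
    (x &&& repunit n) ≡ ∑ i ∈ Finset.range n, (x.testBit (8 * i)).toNat [MOD 255] := by
  induction n generalizing x with
  | zero => simp [repunit, Nat.ModEq]
  | succ n ih =>
    rw [land_repunit_succ, Finset.sum_range_succ']
    refine Nat.ModEq.add_right _ ?_
    have h := ih (x >>> 8)
    simp only [Nat.testBit_shiftRight] at h
    simp only [mul_add, mul_one, add_comm (8 * _) 8]
    have := Nat.ModEq.mul (show 2 ^ 8 ≡ 1 [MOD 255] by decide) h
    rwa [one_mul] at this

/-- The entry in row `i` and column `j` of the `8 × 8` bit matrix stored in `M`. -/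
def entry (M : ℕ) (i j : Fin 8) : Bool := M.testBit (8 * i.val + j.val)

/-- The column `j` of a bit matrix, with one entry in each byte. -/
def column (M j : ℕ) : ℕ := Nat.land (Nat.shiftRight M j) 72340172838076673

/-- The row `j` of a bit matrix. -/
def row (A j : ℕ) : ℕ := Nat.mod (Nat.shiftRight A (Nat.mul 8 j)) 256

/-- The product of column `j` of `M` with row `j` of `A`. -/
def outer (A M j : ℕ) : ℕ := Nat.mul (column M j) (row A j)

/-- The Boolean matrix `M + M A`. -/
def grow (A M : ℕ) : ℕ :=
  Nat.lor M (Nat.lor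
    (Nat.lor (Nat.lor (outer A M 0) (outer A M 1)) (Nat.lor (outer A M 2) (outer A M 3)))
    (Nat.lor (Nat.lor (outer A M 4) (outer A M 5)) (Nat.lor (outer A M 6) (outer A M 7))))

/-- The Boolean matrix `(1 + A) ^ k`, whose rows are the balls of radius `k`. -/
def balls (A : ℕ) : ℕ → ℕ
  | 0 => 9241421688590303745
  | k + 1 => grow A (balls A k)

/-- The number of nonzero entries of a bit matrix. -/
def size (M : ℕ) : ℕ :=
  Nat.mod (Nat.add
    (Nat.add (Nat.add (column M 0) (column M 1)) (Nat.add (column M 2) (column M 3)))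
    (Nat.add (Nat.add (column M 4) (column M 5)) (Nat.add (column M 6) (column M 7)))) 255

/-- The sum over ordered pairs of the distance truncated at `D`. -/
def total (A : ℕ) : ℕ → ℕ
  | 0 => 0
  | D + 1 => Nat.add (total A D) (Nat.sub 64 (size (balls A D)))

theorem column_eq (M j : ℕ) : column M j = (M >>> j) &&& repunit 8 := rfl

theorem entry_outer (A M : ℕ) (w i j : Fin 8) :
    entry (outer A M w) i j = (entry M i w && entry A w j) := by
  have h : outer A M w = ((M >>> w.val) &&& repunit 8) * ((A >>> (8 * w.val)) % 2 ^ 8) := rfl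
  rw [entry, h, testBit_land_repunit_mul (Nat.mod_lt _ (by norm_num)) j.isLt]
  rw [Nat.testBit_mod_two_pow]
  simp [entry, Nat.testBit_shiftRight, add_comm]

theorem entry_lor (M N : ℕ) (i j : Fin 8) :
    entry (Nat.lor M N) i j = (entry M i j || entry N i j) :=
  Nat.testBit_or M N _

theorem entry_grow (A M : ℕ) (i j : Fin 8) :
    entry (grow A M) i j = true ↔
      entry M i j = true ∨ ∃ w, entry M i w = true ∧ entry A w j = true := by
  have h (w : Fin 8) := entry_outer A M w i j
  have hgrow : entry (grow A M) i j = true ↔ entry M i j = true ∨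
      (((entry (outer A M 0) i j = true ∨ entry (outer A M 1) i j = true) ∨
        entry (outer A M 2) i j = true ∨ entry (outer A M 3) i j = true) ∨
      (entry (outer A M 4) i j = true ∨ entry (outer A M 5) i j = true) ∨
        entry (outer A M 6) i j = true ∨ entry (outer A M 7) i j = true) := by
    simp only [grow, entry_lor, Bool.or_eq_true]
  have hexists : (∃ w : Fin 8, entry (outer A M w) i j = true) ↔
      ∃ w, entry M i w = true ∧ entry A w j = true := by simp only [h, Bool.and_eq_true]
  rw [hgrow, ← hexists]
  refine or_congr_right ⟨?_, ?_⟩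
  · rintro (((h | h) | h | h) | (h | h) | h | h)
    exacts [⟨0, h⟩, ⟨1, h⟩, ⟨2, h⟩, ⟨3, h⟩, ⟨4, h⟩, ⟨5, h⟩, ⟨6, h⟩, ⟨7, h⟩]
  · rintro ⟨w, hw⟩
    fin_cases w <;> simp_all

theorem size_eq (M : ℕ) : size M = ∑ i : Fin 8, ∑ j : Fin 8, (entry M i j).toNat := by
  have hcol (j : ℕ) : column M j ≡ ∑ i : Fin 8, (M.testBit (8 * i.val + j)).toNat [MOD 255] := by
    rw [column_eq, Fin.sum_univ_eq_sum_range (fun i => (M.testBit (8 * i + j)).toNat)]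
    simpa only [Nat.testBit_shiftRight, add_comm] using land_repunit_modEq (M >>> j) 8
  have hlt : ∑ i : Fin 8, ∑ j : Fin 8, (entry M i j).toNat < 255 :=
    calc ∑ i : Fin 8, ∑ j : Fin 8, (entry M i j).toNat
        ≤ ∑ _i : Fin 8, ∑ _j : Fin 8, 1 :=
          Finset.sum_le_sum fun i _ => Finset.sum_le_sum fun j _ => Bool.toNat_le _
      _ < 255 := by simp
  rw [← Nat.mod_eq_of_lt hlt, Finset.sum_comm]
  simp only [Fin.sum_univ_eight (fun j : Fin 8 => ∑ i : Fin 8, (entry M i j).toNat)]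
  have h := (((hcol 0).add (hcol 1)).add ((hcol 2).add (hcol 3))).add
    (((hcol 4).add (hcol 5)).add ((hcol 6).add (hcol 7)))
  refine Eq.trans h ?_
  congr 1
  simp only [entry, add_assoc]
  rfl

/-- The bit matrix `A` is the adjacency matrix of `H`. -/
def Encodes (A : ℕ) (H : SimpleGraph (Fin 8)) : Prop :=
  ∀ i j, entry A i j = true ↔ H.Adj i j

theorem Encodes.entry_balls {A : ℕ} {H : SimpleGraph (Fin 8)} (hA : Encodes A H) (k : ℕ)
    (i j : Fin 8) : entry (balls A k) i j = true ↔ ∃ p : H.Walk i j, p.length ≤ k := by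
  induction k generalizing j with
  | zero =>
    have h : ∀ i j : Fin 8, entry 9241421688590303745 i j = true ↔ i = j := by decide
    rw [balls, h]
    constructor
    · rintro rfl; exact ⟨.nil, le_rfl⟩
    · rintro ⟨p, hp⟩; exact p.eq_of_length_eq_zero (Nat.le_zero.mp hp)
  | succ k ih =>
    rw [balls, entry_grow, ih]
    constructor
    · rintro (⟨p, hp⟩ | ⟨w, hw, hwj⟩)
      · exact ⟨p, hp.trans (Nat.le_succ k)⟩
      · obtain ⟨p, hp⟩ := (ih w).mp hw
        exact ⟨p.concat ((hA w j).mp hwj), by simpa using hp⟩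
    · rintro ⟨p, hp⟩
      by_cases hn : p.Nil
      · exact Or.inl ⟨p, by rw [SimpleGraph.Walk.length_eq_zero_iff.mpr hn]; exact Nat.zero_le k⟩
      · refine Or.inr ⟨p.penultimate, (ih _).mpr ⟨p.dropLast, ?_⟩,
          (hA _ _).mpr (p.adj_penultimate hn)⟩
        simp
        omega

theorem Encodes.entry_balls_dist {A : ℕ} {H : SimpleGraph (Fin 8)} (hA : Encodes A H)
    (hH : H.Connected) (k : ℕ) (i j : Fin 8) :
    entry (balls A k) i j = true ↔ H.dist i j ≤ k := by
  rw [hA.entry_balls]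
  constructor
  · rintro ⟨p, hp⟩; exact (SimpleGraph.dist_le p).trans hp
  · intro h
    obtain ⟨p, hp⟩ := hH.exists_walk_length_eq_dist i j
    exact ⟨p, hp.le.trans h⟩

theorem Encodes.total_eq {A : ℕ} {H : SimpleGraph (Fin 8)} (hA : Encodes A H)
    (hH : H.Connected) (D : ℕ) : total A D = ∑ i, ∑ j, min (H.dist i j) D := by
  induction D with
  | zero => simp [total]
  | succ D ih =>
    have hle : size (balls A D) + ∑ i : Fin 8, ∑ j : Fin 8, (!entry (balls A D) i j).toNat = 64 := by
      rw [size_eq, ← Finset.sum_add_distrib]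
      simp only [← Finset.sum_add_distrib]
      rw [Finset.sum_congr rfl fun i _ => Finset.sum_congr rfl fun j _ =>
        show (entry (balls A D) i j).toNat + (!entry (balls A D) i j).toNat = 1 by
          cases entry (balls A D) i j <;> rfl]
      simp
    have hstep : total A (D + 1) = total A D + (64 - size (balls A D)) := rfl
    rw [hstep, ih, ← hle, Nat.add_sub_cancel_left, ← Finset.sum_add_distrib]
    refine Finset.sum_congr rfl fun i _ => ?_
    rw [← Finset.sum_add_distrib]
    refine Finset.sum_congr rfl fun j _ => ?_
    have h := hA.entry_balls_dist hH D i j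
    cases hb : entry (balls A D) i j <;> simp [hb] at h ⊢ <;> omega

theorem Encodes.connected {A : ℕ} {H : SimpleGraph (Fin 8)} (hA : Encodes A H) {k : ℕ}
    (hk : ∀ j, entry (balls A k) 0 j = true) : H.Connected := by
  have h (j : Fin 8) : H.Reachable 0 j := by
    obtain ⟨p, -⟩ := (hA.entry_balls k 0 j).mp (hk j)
    exact ⟨p⟩
  exact ⟨fun i j => (h i).symm.trans (h j)⟩

theorem Encodes.wienerIndex_eq {A : ℕ} {H : SimpleGraph (Fin 8)} (hA : Encodes A H)
    (hH : H.Connected) {D : ℕ} (hD : ∀ i j, H.dist i j ≤ D) :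
    wienerIndex H = (total A D : ℚ) / 2 := by
  rw [wienerIndex, hA.total_eq hH]
  simp only [min_eq_left (hD _ _)]
  push_cast
  rfl

theorem Encodes.wienerIndex_eq_of_balls {A : ℕ} {H : SimpleGraph (Fin 8)} (hA : Encodes A H)
    {D : ℕ} (hD : ∀ i j, entry (balls A D) i j = true) :
    wienerIndex H = (total A D : ℚ) / 2 :=
  have hH := hA.connected (hD 0)
  hA.wienerIndex_eq hH fun i j => (hA.entry_balls_dist hH D i j).mp (hD i j)


/-- The unordered pairs of distinct vertices, sorted by their larger element. -/
def pairs : List (Fin 8 × Fin 8) :=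
  [(0, 1), (0, 2), (1, 2), (0, 3), (1, 3), (2, 3), (0, 4), (1, 4), (2, 4), (3, 4),
   (0, 5), (1, 5), (2, 5), (3, 5), (4, 5), (0, 6), (1, 6), (2, 6), (3, 6), (4, 6), (5, 6),
   (0, 7), (1, 7), (2, 7), (3, 7), (4, 7), (5, 7), (6, 7)]

/-- The bit matrix `A` with the entries of the edge `p` set. -/
def addEdge (A : ℕ) (p : Fin 8 × Fin 8) : ℕ :=
  A ||| (1 <<< (8 * p.1.val + p.2.val)) ||| (1 <<< (8 * p.2.val + p.1.val))

/-- Both ends of `p` lie on the initial path `0, …, d`. -/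
def onPath (d : ℕ) (p : Fin 8 × Fin 8) : Bool := Nat.ble p.2.val d

/-- The ends of `p` are consecutive numbers. -/
def consecutive (p : Fin 8 × Fin 8) : Bool := Nat.beq (p.1.val + 1) p.2.val

/-- `search d P ps k A` tests `P` on all bit matrices obtained from `A` by adding `k` of the
edges listed in `ps`, where the edges within `0, …, d` are those of the path. -/
def search (d : ℕ) (P : ℕ → Bool) : List (Fin 8 × Fin 8) → ℕ → ℕ → Bool
  | [], 0, A => P A
  | [], _ + 1, _ => true
  | p :: ps, 0, A => (onPath d p && consecutive p) || search d P ps 0 A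
  | p :: ps, k + 1, A =>
    ((onPath d p && !consecutive p) || search d P ps k (addEdge A p)) &&
      ((onPath d p && consecutive p) || search d P ps (k + 1) A)

theorem entry_addEdge (A : ℕ) (p : Fin 8 × Fin 8) (i j : Fin 8) :
    entry (addEdge A p) i j = true ↔ entry A i j = true ∨ (i, j) = p ∨ (j, i) = p := by
  obtain ⟨a, b⟩ := p
  simp only [entry, addEdge, Nat.one_shiftLeft, Nat.testBit_or, Nat.testBit_two_pow,
    Bool.or_eq_true, decide_eq_true_eq, Prod.mk.injEq, Fin.ext_iff, or_assoc]
  have h₁ : 8 * a.val + b.val = 8 * i.val + j.val ↔ i.val = a.val ∧ j.val = b.val := by omega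
  have h₂ : 8 * b.val + a.val = 8 * i.val + j.val ↔ j.val = a.val ∧ i.val = b.val := by omega
  rw [h₁, h₂]

theorem exists_of_search {d : ℕ} {P : ℕ → Bool} {H : SimpleGraph (Fin 8)}
    {ps : List (Fin 8 × Fin 8)} {k A : ℕ} (hsearch : search d P ps k A = true)
    (hpath : ∀ p ∈ ps, onPath d p = true → (H.Adj p.1 p.2 ↔ consecutive p = true))
    (hcount : ps.countP (fun p => decide (H.Adj p.1 p.2)) = k)
    (hsub : ∀ i j, entry A i j = true → H.Adj i j)
    (hsup : ∀ i j, H.Adj i j → entry A i j = true ∨ (i, j) ∈ ps ∨ (j, i) ∈ ps) :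
    ∃ B, Encodes B H ∧ P B = true := by
  induction ps generalizing k A with
  | nil =>
    obtain rfl : k = 0 := by simpa using hcount.symm
    exact ⟨A, fun i j => ⟨hsub i j, fun h => by simpa using hsup i j h⟩, hsearch⟩
  | cons p ps ih =>
    have hp := hpath p List.mem_cons_self
    have hps : ∀ q ∈ ps, onPath d q = true → (H.Adj q.1 q.2 ↔ consecutive q = true) :=
      fun q hq => hpath q (List.mem_cons_of_mem _ hq)
    by_cases hadj : H.Adj p.1 p.2
    · rw [List.countP_cons_of_pos (by simpa using hadj)] at hcount
      subst hcount
      rw [search, Bool.and_eq_true] at hsearch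
      refine ih (A := addEdge A p) ?_ hps rfl ?_ ?_
      · have hno : (onPath d p && !consecutive p) = false := by
          by_cases h : onPath d p = true <;> simp_all
        simpa [hno] using hsearch.1
      · intro i j h
        rcases (entry_addEdge A p i j).mp h with h | rfl | rfl
        exacts [hsub i j h, hadj, hadj.symm]
      · intro i j h
        rw [entry_addEdge]
        have := hsup i j h
        simp only [List.mem_cons] at this
        tauto
    · rw [List.countP_cons_of_neg (by simpa using hadj)] at hcount
      have hno : (onPath d p && consecutive p) = false := by
        by_cases h : onPath d p = true <;> simp_all
      refine ih (k := k) (A := A) ?_ hps hcount hsub ?_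
      · cases k with
        | zero => simpa [search, hno] using hsearch
        | succ k =>
          rw [search, Bool.and_eq_true] at hsearch
          simpa [hno] using hsearch.2
      · intro i j h
        have hij : (i, j) ≠ p := by rintro rfl; exact hadj h
        have hji : (j, i) ≠ p := by rintro rfl; exact hadj h.symm
        simpa [hij, hji] using hsup i j h

/-- The adjacency matrices of `B(8,0)`, `B(8,1)`, `B(8,2)`, `B_8^{(1)}` and `B_8^{3,3}`. -/
def extremal : List ℕ :=
  [8115715948830917890, 4044461887835473154, 2026708517293524226, 3472505007889843458,
   6962793894468322566]

/-- The relabellings needed to compare a graph with the matrices in `extremal`. -/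
def relabellings : List (Fin 8 → Fin 8) :=
  [![0, 1, 2, 3, 4, 5, 6, 7], ![6, 5, 4, 3, 2, 1, 0, 7], ![5, 4, 3, 2, 1, 0, 6, 7],
   ![6, 4, 3, 2, 1, 0, 5, 7], ![6, 4, 3, 2, 1, 0, 7, 5], ![0, 1, 2, 3, 4, 6, 5, 7],
   ![0, 1, 2, 3, 4, 6, 7, 5], ![0, 2, 3, 4, 5, 6, 1, 7], ![0, 2, 3, 4, 5, 6, 7, 1]]

/-- `A` becomes one of the matrices in `extremal` after one of the relabellings. -/
def isExtremal (A : ℕ) : Bool :=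
  relabellings.any fun s => extremal.any fun T =>
    (List.finRange 8).all fun i => (List.finRange 8).all fun j =>
      entry A i j == entry T (s i) (s j)

/-- The test applied to graphs with diametral path `0, …, d`: either `A` has a shortcut between
`0` and `d`, or its Wiener index is at most `68`, or its diameter exceeds `d`, or it is one of
the extremal graphs. -/
def admissible (d A : ℕ) : Bool :=
  Nat.testBit (balls A (Nat.pred d)) d || (Nat.ble (total A d) 136 ||
    (!(Nat.beq (size (balls A d)) 64) || isExtremal A))

theorem search_admissible_four : search 4 (admissible 4) pairs 9 0 = true := by
  decide +kernel

theorem search_admissible_five : search 5 (admissible 5) pairs 9 0 = true := by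
  decide +kernel

theorem search_admissible_six : search 6 (admissible 6) pairs 9 0 = true := by
  decide +kernel

theorem search_admissible_seven : search 7 (admissible 7) pairs 9 0 = true := by
  decide +kernel

theorem encodes_Bgraph_zero : Encodes 8115715948830917890 (Bgraph 8 0) := by
  simp only [Encodes, Bgraph, SimpleGraph.fromRel_adj]
  decide

theorem encodes_Bgraph_one : Encodes 4044461887835473154 (Bgraph 8 1) := by
  simp only [Encodes, Bgraph, SimpleGraph.fromRel_adj]
  decide

theorem encodes_Bgraph_two : Encodes 2026708517293524226 (Bgraph 8 2) := by
  simp only [Encodes, Bgraph, SimpleGraph.fromRel_adj]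
  decide

theorem encodes_Bn1 : Encodes 3472505007889843458 (Bn1 8) := by
  simp only [Encodes, Bn1, SimpleGraph.fromRel_adj]
  decide

theorem encodes_B33 : Encodes 6962793894468322566 (B33 8) := by
  simp only [Encodes, B33, SimpleGraph.fromRel_adj]
  decide

theorem wienerIndex_Bgraph_zero : wienerIndex (Bgraph 8 0) = 73 := by
  rw [encodes_Bgraph_zero.wienerIndex_eq_of_balls (D := 7) (by decide +kernel),
    show total 8115715948830917890 7 = 146 by decide +kernel]
  norm_num

theorem wienerIndex_Bgraph_one : wienerIndex (Bgraph 8 1) = 70 := by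
  rw [encodes_Bgraph_one.wienerIndex_eq_of_balls (D := 7) (by decide +kernel),
    show total 4044461887835473154 7 = 140 by decide +kernel]
  norm_num

theorem wienerIndex_Bgraph_two : wienerIndex (Bgraph 8 2) = 69 := by
  rw [encodes_Bgraph_two.wienerIndex_eq_of_balls (D := 7) (by decide +kernel),
    show total 2026708517293524226 7 = 138 by decide +kernel]
  norm_num

theorem wienerIndex_Bn1 : wienerIndex (Bn1 8) = 69 := by
  rw [encodes_Bn1.wienerIndex_eq_of_balls (D := 7) (by decide +kernel),
    show total 3472505007889843458 7 = 138 by decide +kernel]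
  norm_num

theorem wienerIndex_B33 : wienerIndex (B33 8) = 72 := by
  rw [encodes_B33.wienerIndex_eq_of_balls (D := 7) (by decide +kernel),
    show total 6962793894468322566 7 = 144 by decide +kernel]
  norm_num

/-- `G` is isomorphic to `B(8,0)`, `B(8,1)`, `B(8,2)`, `B_8^{(1)}` or `B_8^{3,3}`. -/
def IsExceptional {V : Type*} (G : SimpleGraph V) : Prop :=
  Nonempty (G ≃g Bgraph 8 0) ∨ Nonempty (G ≃g Bgraph 8 1) ∨ Nonempty (G ≃g Bgraph 8 2) ∨
    Nonempty (G ≃g Bn1 8) ∨ Nonempty (G ≃g B33 8)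

theorem Encodes.isExceptional {A : ℕ} {H : SimpleGraph (Fin 8)} (hA : Encodes A H)
    (h : isExtremal A = true) : IsExceptional H := by
  have hinj : ∀ s ∈ relabellings, ∀ i j, s i = s j → i = j := by
    simp only [relabellings, List.forall_mem_cons, List.not_mem_nil, false_imp_iff, implies_true,
      and_true]
    decide +kernel
  simp only [isExtremal, List.any_eq_true, List.all_eq_true, List.mem_finRange, beq_iff_eq,
    forall_const] at h
  obtain ⟨s, hs, T, hT, hsT⟩ := h
  have key {K : SimpleGraph (Fin 8)} (hK : Encodes T K) : Nonempty (H ≃g K) :=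
    ⟨⟨Equiv.ofBijective s (Finite.injective_iff_bijective.mp fun i j => hinj s hs i j), fun {i j} => by
      rw [← hA, hsT, hK]; rfl⟩⟩
  simp only [extremal, List.mem_cons, List.not_mem_nil, or_false] at hT
  rcases hT with rfl | rfl | rfl | rfl | rfl
  · exact Or.inl (key encodes_Bgraph_zero)
  · exact Or.inr (Or.inl (key encodes_Bgraph_one))
  · exact Or.inr (Or.inr (Or.inl (key encodes_Bgraph_two)))
  · exact Or.inr (Or.inr (Or.inr (Or.inl (key encodes_Bn1))))
  · exact Or.inr (Or.inr (Or.inr (Or.inr (key encodes_B33))))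

theorem sum_adj_eq {V : Type*} [Fintype V] {H : SimpleGraph V} {m : ℕ}
    (hm : H.edgeSet.ncard = m) : ∑ i, ∑ j, (if H.Adj i j then 1 else 0) = 2 * m := by
  rw [← hm, Set.ncard_eq_toFinset_card', ← SimpleGraph.edgeFinset,
    ← H.sum_degrees_eq_twice_card_edges]
  refine Finset.sum_congr rfl fun i _ => ?_
  rw [← Finset.card_filter, ← SimpleGraph.card_neighborFinset_eq_degree,
    SimpleGraph.neighborFinset_eq_filter]

theorem countP_pairs {H : SimpleGraph (Fin 8)} {m : ℕ} (hm : H.edgeSet.ncard = m) :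
    pairs.countP (fun p => decide (H.Adj p.1 p.2)) = m := by
  have hlist : ∀ l : List (Fin 8 × Fin 8), l.countP (fun p => decide (H.Adj p.1 p.2)) =
      (l.map fun p => if H.Adj p.1 p.2 then 1 else 0).sum := by
    intro l
    induction l with
    | nil => rfl
    | cons p l ih => simp [List.countP_cons, ih, add_comm]
  have hsum := sum_adj_eq hm
  generalize hf : (fun i j => if H.Adj i j then 1 else 0 : Fin 8 → Fin 8 → ℕ) = f
  have hfun (i j : Fin 8) : (if H.Adj i j then 1 else 0 : ℕ) = f i j := by rw [← hf]
  have hdiag (i : Fin 8) : f i i = 0 := by rw [← hfun]; simp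
  have hsymm (i j : Fin 8) : f i j = f j i := by rw [← hfun, ← hfun, H.adj_comm]
  rw [hlist]
  simp only [hfun, Fin.sum_univ_eight, hdiag] at hsum
  simp only [hfun, pairs, List.map_cons, List.map_nil, List.sum_cons, List.sum_nil]
  rw [hsymm 1 0, hsymm 2 0, hsymm 3 0, hsymm 4 0, hsymm 5 0, hsymm 6 0, hsymm 7 0,
    hsymm 2 1, hsymm 3 1, hsymm 4 1, hsymm 5 1, hsymm 6 1, hsymm 7 1,
    hsymm 3 2, hsymm 4 2, hsymm 5 2, hsymm 6 2, hsymm 7 2,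
    hsymm 4 3, hsymm 5 3, hsymm 6 3, hsymm 7 3,
    hsymm 5 4, hsymm 6 4, hsymm 7 4, hsymm 6 5, hsymm 7 5, hsymm 7 6] at hsum
  linarith

theorem exists_initial_geodesic {V : Type*} [Fintype V] {G : SimpleGraph V} {n : ℕ}
    (hcard : Fintype.card V = n) (hG : G.Connected) :
    ∃ (e : Fin n ≃ V) (d : ℕ), d < n ∧ (∀ u v, G.dist u v ≤ d) ∧
      ∀ i j : Fin n, i ≤ j → j.val ≤ d → G.dist (e i) (e j) = j.val - i.val := by
  obtain ⟨v₀⟩ := hG.nonempty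
  obtain ⟨⟨u, v⟩, -, hmax⟩ := Finset.exists_max_image Finset.univ
    (fun q : V × V => G.dist q.1 q.2) ⟨(v₀, v₀), Finset.mem_univ _⟩
  obtain ⟨p, hp⟩ := hG.exists_walk_length_eq_dist u v
  have hpath := p.isPath_of_length_eq_dist hp
  have hlt : p.length < n := hcard ▸ hpath.length_lt
  have hdist (i j : ℕ) (hij : i ≤ j) (hj : j ≤ p.length) :
      G.dist (p.getVert i) (p.getVert j) = j - i := by
    have h₁ := SimpleGraph.dist_le (p.take i)
    have h₂ := SimpleGraph.dist_le (p.drop j)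
    have h₃ := SimpleGraph.dist_le ((p.drop i).take (j - i))
    have h₄ := hG.dist_triangle (u := u) (v := p.getVert i) (w := v)
    have h₅ := hG.dist_triangle (u := p.getVert i) (v := p.getVert j) (w := v)
    simp only [SimpleGraph.Walk.take_length, SimpleGraph.Walk.drop_length,
      SimpleGraph.Walk.drop_getVert, Nat.add_sub_cancel' hij] at h₁ h₂ h₃
    omega
  obtain ⟨g, hg⟩ := Finset.exists_equiv_extend_of_card_eq (α := Fin n) (t := (Finset.univ : Finset V))
    (by simp [hcard]) (s := Finset.univ.filter fun i : Fin n => i.val ≤ p.length)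
    (f := fun i => p.getVert i.val) (Finset.subset_univ _) (by
      intro i hi j hj hij
      simp only [Finset.coe_filter, Finset.mem_univ, true_and, Set.mem_ofPred_eq] at hi hj
      exact Fin.ext (hpath.getVert_injOn hi hj hij))
  refine ⟨g.trans (Equiv.subtypeUnivEquiv Finset.mem_univ), p.length, hlt, ?_, ?_⟩
  · intro a b
    rw [hp]
    exact hmax (a, b) (Finset.mem_univ _)
  · intro i j hij hj
    have hi : i.val ≤ p.length := le_trans hij hj
    simp only [Equiv.trans_apply, Equiv.subtypeUnivEquiv_apply]
    rw [hg i (by simpa using hi), hg j (by simpa using hj)]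
    exact hdist i j hij hj

theorem dist_iso {V W : Type*} {G : SimpleGraph V} {H : SimpleGraph W} (hG : G.Connected)
    (e : G ≃g H) (u v : V) : H.dist (e u) (e v) = G.dist u v := by
  have hH := e.connected_iff.mp hG
  apply le_antisymm
  · obtain ⟨p, hp⟩ := hG.exists_walk_length_eq_dist u v
    simpa [hp] using SimpleGraph.dist_le (p.map e.toHom)
  · obtain ⟨p, hp⟩ := hH.exists_walk_length_eq_dist (e u) (e v)
    have h := SimpleGraph.dist_le (p.map e.symm.toHom)
    rw [SimpleGraph.Walk.length_map, hp] at h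
    simpa using h

theorem wienerIndex_iso {V W : Type*} [Fintype V] [Fintype W] {G : SimpleGraph V}
    {H : SimpleGraph W} (hG : G.Connected) (e : G ≃g H) : wienerIndex G = wienerIndex H := by
  rw [wienerIndex, wienerIndex]
  congr 1
  refine Fintype.sum_equiv e.toEquiv _ _ fun u => Fintype.sum_equiv e.toEquiv _ _ fun v => ?_
  exact congrArg Nat.cast (dist_iso hG e u v).symm

theorem wienerIndex_le_of_dist_le_three {V : Type*} [Fintype V] {G : SimpleGraph V}
    (hcard : Fintype.card V = 8) (hbic : G.edgeSet.ncard = 9) (h : ∀ u v, G.dist u v ≤ 3) :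
    wienerIndex G ≤ 66 := by
  have hle : ∑ u, ∑ v, (G.dist u v + 2 * (if G.Adj u v then 1 else 0) +
      3 * (if u = v then 1 else 0)) ≤ ∑ _u : V, ∑ _v : V, 3 := by
    refine Finset.sum_le_sum fun u _ => Finset.sum_le_sum fun v _ => ?_
    have huv := h u v
    split_ifs with h₁ h₂ h₂
    · exact absurd h₂ h₁.ne
    · simp [SimpleGraph.dist_eq_one_iff_adj.mpr h₁]
    · simp [h₂]
    · simpa using huv
  simp only [Finset.sum_add_distrib, ← Finset.mul_sum, sum_adj_eq hbic] at hle
  simp only [Finset.sum_ite_eq, Finset.mem_univ, if_true, Finset.sum_const, Finset.card_univ,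
    hcard, smul_eq_mul] at hle
  have hnat : ∑ u, ∑ v, G.dist u v ≤ 132 := by omega
  have hq : (∑ u, ∑ v, (G.dist u v : ℚ)) ≤ 132 := by exact_mod_cast hnat
  rw [wienerIndex]
  linarith

theorem isExceptional_or_wienerIndex_le_of_geodesic {H : SimpleGraph (Fin 8)} (hH : H.Connected)
    (hbic : H.edgeSet.ncard = 9) {d : ℕ} (hd : d < 8) (hdiam : ∀ i j, H.dist i j ≤ d)
    (hgeo : ∀ i j : Fin 8, i ≤ j → j.val ≤ d → H.dist i j = j.val - i.val) :
    IsExceptional H ∨ wienerIndex H ≤ 68 := by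
  by_cases hd3 : d ≤ 3
  · have := wienerIndex_le_of_dist_le_three (by simp) hbic fun i j => (hdiam i j).trans hd3
    exact Or.inr (by linarith)
  have hsearch : search d (admissible d) pairs 9 0 = true := by
    obtain rfl | rfl | rfl | rfl : d = 4 ∨ d = 5 ∨ d = 6 ∨ d = 7 := by omega
    exacts [search_admissible_four, search_admissible_five, search_admissible_six,
      search_admissible_seven]
  have hlt : ∀ p ∈ pairs, p.1 ≤ p.2 := by decide
  have hmem : ∀ i j : Fin 8, i ≠ j → (i, j) ∈ pairs ∨ (j, i) ∈ pairs := by decide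
  obtain ⟨A, hA, hadm⟩ := exists_of_search hsearch
    (fun p hp hon => by
      rw [← SimpleGraph.dist_eq_one_iff_adj, hgeo p.1 p.2 (hlt p hp) (Nat.le_of_ble_eq_true hon),
        consecutive, Nat.beq_eq]
      omega)
    (countP_pairs hbic) (fun i j h => by simp [entry] at h)
    (fun i j h => Or.inr (hmem i j h.ne))
  have hshort : Nat.testBit (balls A (Nat.pred d)) d = false := by
    have h := hA.entry_balls_dist hH (Nat.pred d) 0 ⟨d, hd⟩
    rw [hgeo 0 ⟨d, hd⟩ (Fin.zero_le _) le_rfl] at h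
    simp only [entry, Fin.val_zero, mul_zero, zero_add, Nat.pred_eq_sub_one] at h
    rw [← Bool.not_eq_true, Nat.pred_eq_sub_one, h]
    omega
  simp only [admissible, hshort, Bool.false_or, Bool.or_eq_true] at hadm
  rcases hadm with h | h | h
  · right
    have hle : total A d ≤ 136 := Nat.le_of_ble_eq_true h
    have hq : (total A d : ℚ) ≤ 136 := by exact_mod_cast hle
    rw [hA.wienerIndex_eq hH hdiam]
    linarith
  · have hall (i j : Fin 8) : entry (balls A d) i j = true :=
      (hA.entry_balls_dist hH d i j).mpr (hdiam i j)
    simp [size_eq, hall] at h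
  · exact Or.inl (hA.isExceptional h)

theorem isExceptional_or_wienerIndex_le {V : Type*} [Fintype V] {G : SimpleGraph V}
    (hcard : Fintype.card V = 8) (hG : G.Connected) (hbic : G.edgeSet.ncard = 9) :
    IsExceptional G ∨ wienerIndex G ≤ 68 := by
  obtain ⟨e, d, hd, hdiam, hgeo⟩ := exists_initial_geodesic hcard hG
  let φ : G.comap e ≃g G := SimpleGraph.Iso.comap e G
  have hH : (G.comap e).Connected := φ.connected_iff.mpr hG
  have hdist (i j : Fin 8) : (G.comap e).dist i j = G.dist (e i) (e j) := (dist_iso hH φ i j).symm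
  have hedges : (G.comap e).edgeSet.ncard = 9 := by
    rw [← hbic]
    exact Nat.card_congr φ.mapEdgeSet
  rw [← wienerIndex_iso hH φ]
  refine (isExceptional_or_wienerIndex_le_of_geodesic hH hedges hd
    (fun i j => hdist i j ▸ hdiam _ _) (fun i j hij hj => hdist i j ▸ hgeo i j hij hj)).imp_left ?_
  have htrans {K : SimpleGraph (Fin 8)} : Nonempty (G.comap e ≃g K) → Nonempty (G ≃g K) :=
    Nonempty.map φ.symm.trans
  exact Or.imp htrans (Or.imp htrans (Or.imp htrans (Or.imp htrans htrans)))

end BitMatrix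

/-- Bicyclic graphs of order `8` outside
`{B(8,0), B(8,1), B(8,2), B_8^{(1)}, B_8^{3,3}}`. -/
theorem bicyclic_wiener_order_eight
    {V : Type*} [Fintype V] (G : SimpleGraph V)
    (hcard : Fintype.card V = 8)
    (hconn : G.Connected) (hbic : G.edgeSet.ncard = 9)
    (hB1 : ¬ Nonempty (G ≃g Bgraph 8 0)) (hB2 : ¬ Nonempty (G ≃g Bgraph 8 1))
    (hB3 : ¬ Nonempty (G ≃g Bgraph 8 2))
    (hB4 : ¬ Nonempty (G ≃g Bn1 8)) (hB5 : ¬ Nonempty (G ≃g B33 8)) :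
    wienerIndex G < wienerIndex (Bgraph 8 2) ∧
    wienerIndex (Bgraph 8 2) = wienerIndex (Bn1 8) ∧
    wienerIndex (Bn1 8) < wienerIndex (Bgraph 8 1) ∧
    wienerIndex (Bgraph 8 1) < wienerIndex (B33 8) ∧
    wienerIndex (B33 8) < wienerIndex (Bgraph 8 0) := by
  rw [BitMatrix.wienerIndex_Bgraph_zero, BitMatrix.wienerIndex_Bgraph_one,
    BitMatrix.wienerIndex_Bgraph_two, BitMatrix.wienerIndex_Bn1, BitMatrix.wienerIndex_B33]
  refine ⟨?_, by norm_num, by norm_num, by norm_num, by norm_num⟩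
  rcases BitMatrix.isExceptional_or_wienerIndex_le hcard hconn hbic with (h | h | h | h | h) | h
  exacts [absurd h hB1, absurd h hB2, absurd h hB3, absurd h hB4, absurd h hB5, by linarith]
end
end
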